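/- Let n ≥ 2, N > 0, and M ≥ 2. There exist a natural number T and a constant C > 0 (depending only on n, N, M) such that: for every not identically zero harmonic function u on B(0,M) ⊂ ℝⁿ whose frequency satisfies β_u(0,r) ≤ N for all 0 < r < M, one has sup_{B(0,1/8)} |u|² ≤ C · Σ_{m=0}^{T} Σ_{|α|=m} |D^α u(0)|². -/

import Mathlib

open MeasureTheory Metric

noncomputable section

/-- Partial derivative in the `i`-th coordinate direction. -/
def pd {n : ℕ} (i : Fin n) (u : EuclideanSpace ℝ (Fin n) → ℝ) :
    EuclideanSpace ℝ (Fin n) → ℝ :=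
  fun x => fderiv ℝ u x (EuclideanSpace.single i 1)

/-- Iterated partial derivative `D^α u` for a multi-index `α : Fin n → ℕ`. -/
def mderiv {n : ℕ} (α : Fin n → ℕ) (u : EuclideanSpace ℝ (Fin n) → ℝ) :
    EuclideanSpace ℝ (Fin n) → ℝ :=
  (List.finRange n).foldr (fun i v => (pd i)^[α i] v) u

/-- `Σ_{|α| ≤ N} |D^α u x|`, the sum over all multi-indices of order at most `N`. -/
def derivSum {n : ℕ} (N : ℕ) (u : EuclideanSpace ℝ (Fin n) → ℝ)
    (x : EuclideanSpace ℝ (Fin n)) : ℝ :=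
  ∑ α ∈ Finset.univ.filter (fun α : Fin n → Fin (N + 1) => (∑ i, (α i : ℕ)) ≤ N),
    |mderiv (fun i => (α i : ℕ)) u x|

/-- `sup_{B(c,r)} |u|` over the closed ball `B(c,r)`. -/
def supBall {n : ℕ} (u : EuclideanSpace ℝ (Fin n) → ℝ) (c : EuclideanSpace ℝ (Fin n))
    (r : ℝ) : ℝ :=
  ⨆ x : closedBall c r, |u x|

/-- Frequency function `β_u(0,r)` of a harmonic function `u`. -/
def hfreq {n : ℕ} (u : EuclideanSpace ℝ (Fin n) → ℝ) (r : ℝ) : ℝ :=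
  r * (∫ x in closedBall (0 : EuclideanSpace ℝ (Fin n)) r, ∑ i, (pd i u x) ^ 2) /
    ∫ x in sphere (0 : EuclideanSpace ℝ (Fin n)) r, u x ^ 2 ∂ μH[(n : ℝ) - 1]

open scoped ENNReal NNReal

/-- Integration in polar coordinates for the Lebesgue integral of nonnegative functions. -/
theorem lintegral_eq_lintegral_polar {n : ℕ} (hn : 0 < n)
    (g : EuclideanSpace ℝ (Fin n) → ℝ≥0∞) (hg : Measurable g) :
    ∫⁻ x, g x = ∫⁻ s in Set.Ioi (0 : ℝ), ENNReal.ofReal (s ^ (n - 1)) *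
      ∫⁻ ω : sphere (0 : EuclideanSpace ℝ (Fin n)) 1, g (s • (ω : EuclideanSpace ℝ (Fin n)))
        ∂(volume : Measure (EuclideanSpace ℝ (Fin n))).toSphere := by
  have : Nonempty (Fin n) := ⟨⟨0, hn⟩⟩
  set μ : Measure (EuclideanSpace ℝ (Fin n)) := volume with hμ
  have hmp := μ.measurePreserving_homeomorphUnitSphereProd
  have hG : Measurable fun p : sphere (0 : EuclideanSpace ℝ (Fin n)) 1 × Set.Ioi (0 : ℝ) =>
      g (p.2.1 • p.1.1) := by fun_prop
  have h1 : ∫⁻ x, g x ∂μ = ∫⁻ x : ({(0)}ᶜ : Set (EuclideanSpace ℝ (Fin n))), g x.1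
      ∂(μ.comap (↑)) := by
    rw [lintegral_subtype_comap (measurableSet_singleton _).compl g, restrict_compl_singleton]
  rw [h1]
  have h2 : ∀ x : ({(0)}ᶜ : Set (EuclideanSpace ℝ (Fin n))), g x.1 =
      (fun p : sphere (0 : EuclideanSpace ℝ (Fin n)) 1 × Set.Ioi (0 : ℝ) =>
      g (p.2.1 • p.1.1)) (homeomorphUnitSphereProd (EuclideanSpace ℝ (Fin n)) x) := by
    intro x
    have hx : ‖x.1‖ ≠ 0 := norm_ne_zero_iff.2 x.2
    simp [smul_smul, mul_inv_cancel₀ hx]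
  simp_rw [h2]
  rw [hmp.lintegral_comp hG, lintegral_prod_symm' _ hG]
  simp only [finrank_euclideanSpace, Fintype.card_fin]
  rw [Measure.volumeIoiPow, lintegral_withDensity_eq_lintegral_mul]
  · rw [← lintegral_subtype_comap measurableSet_Ioi]
    rfl
  · fun_prop
  · exact hG.lintegral_prod_left

theorem toSphere_ball_ge {n : ℕ} (hn : 0 < n) :
    ∃ c : ℝ≥0, 0 < c ∧ ∀ (x : sphere (0 : EuclideanSpace ℝ (Fin n)) 1) (ε : ℝ), 0 < ε → ε ≤ 1 →
      (c : ℝ≥0∞) * ENNReal.ofReal ε ^ (n - 1) ≤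
        (volume : Measure (EuclideanSpace ℝ (Fin n))).toSphere (closedBall x ε) := by
  have : Nonempty (Fin n) := ⟨⟨0, hn⟩⟩
  set μ : Measure (EuclideanSpace ℝ (Fin n)) := volume with hμ
  have hV0 : μ (ball 0 1) ≠ 0 := (measure_ball_pos _ _ one_pos).ne'
  have hVt : μ (ball 0 1) ≠ ∞ := measure_ball_lt_top.ne
  refine ⟨(μ (ball 0 1)).toNNReal * (1 / 4) ^ n, ?_, ?_⟩
  · have := ENNReal.toNNReal_pos hV0 hVt
    positivity
  intro x ε hε hε1
  have key : μ (ball x.1 (ε / 2)) ≤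
      ENNReal.ofReal (2 ^ (n - 1)) * ENNReal.ofReal ε * μ.toSphere (closedBall x ε) := by
    rw [← lintegral_indicator_one measurableSet_ball,
      lintegral_eq_lintegral_polar hn _ (measurable_one.indicator measurableSet_ball)]
    calc _ ≤ ∫⁻ s in Set.Ioi (0 : ℝ), (Set.Ioo (1 - ε / 2) (1 + ε / 2)).indicator
            (fun _ => ENNReal.ofReal (2 ^ (n - 1)) * μ.toSphere (closedBall x ε)) s := by
          refine setLIntegral_mono' measurableSet_Ioi fun s (hs : 0 < s) => ?_
          have hsub : ∀ ω : sphere (0 : EuclideanSpace ℝ (Fin n)) 1,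
              s • ω.1 ∈ ball x.1 (ε / 2) → s ∈ Set.Ioo (1 - ε / 2) (1 + ε / 2) ∧
                ω ∈ closedBall x ε := by
            intro ω h
            have hω : ‖ω.1‖ = 1 := by simp
            have hx : ‖x.1‖ = 1 := by simp
            rw [mem_ball, dist_eq_norm] at h
            have h1 : |s - 1| < ε / 2 := by
              refine lt_of_le_of_lt ?_ h
              have := abs_norm_sub_norm_le (s • ω.1) x.1
              rwa [norm_smul, hω, hx, Real.norm_of_nonneg hs.le, mul_one] at this
            refine ⟨⟨by linarith [(abs_lt.1 h1).1], by linarith [(abs_lt.1 h1).2]⟩, ?_⟩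
            rw [mem_closedBall, Subtype.dist_eq, dist_eq_norm]
            have h2 : ω.1 - x.1 = (s • ω.1 - x.1) - (s - 1) • ω.1 := by
              rw [sub_smul, one_smul]; abel
            rw [h2]
            refine (norm_sub_le _ _).trans ?_
            rw [norm_smul, hω, Real.norm_eq_abs]
            linarith
          by_cases hs' : s ∈ Set.Ioo (1 - ε / 2) (1 + ε / 2)
          · rw [Set.indicator_of_mem hs']
            gcongr
            · linarith [hs'.2]
            · rw [← lintegral_indicator_one measurableSet_closedBall]
              refine lintegral_mono fun ω => ?_
              by_cases h : s • ω.1 ∈ ball x.1 (ε / 2)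
              · rw [Set.indicator_of_mem h, Set.indicator_of_mem (hsub ω h).2]; rfl
              · rw [Set.indicator_of_notMem h]; exact zero_le
          · have : ∀ ω : sphere (0 : EuclideanSpace ℝ (Fin n)) 1,
                (ball x.1 (ε / 2)).indicator (1 : EuclideanSpace ℝ (Fin n) → ℝ≥0∞) (s • ω.1) = 0 := fun ω =>
              Set.indicator_of_notMem (fun h => hs' (hsub ω h).1) _
            rw [lintegral_congr this]
            simp
      _ ≤ ∫⁻ s, (Set.Ioo (1 - ε / 2) (1 + ε / 2)).indicator
            (fun _ => ENNReal.ofReal (2 ^ (n - 1)) * μ.toSphere (closedBall x ε)) s :=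
          setLIntegral_le_lintegral _ _
      _ = _ := by
          rw [lintegral_indicator_const measurableSet_Ioo, Real.volume_Ioo]
          rw [show 1 + ε / 2 - (1 - ε / 2) = ε by ring]
          ring
  rw [μ.addHaar_ball_of_pos _ (by positivity), finrank_euclideanSpace, Fintype.card_fin] at key
  have h0 : ENNReal.ofReal (2 ^ (n - 1)) * ENNReal.ofReal ε ≠ 0 := by
    simp [hε]
  have ht : ENNReal.ofReal (2 ^ (n - 1)) * ENNReal.ofReal ε ≠ ∞ := by
    exact ENNReal.mul_ne_top ENNReal.ofReal_ne_top ENNReal.ofReal_ne_top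
  rw [← ENNReal.mul_le_mul_iff_right h0 ht]
  refine le_trans ?_ key
  rw [ENNReal.coe_mul, ENNReal.coe_toNNReal hVt]
  have e1 : ((((1 / 4 : ℝ≥0) ^ n : ℝ≥0)) : ℝ≥0∞) = ENNReal.ofReal ((1 / 4) ^ n) := by
    rw [ENNReal.ofReal, Real.toNNReal_pow (by norm_num)]
    congr 2
    ext; simp
  rw [e1, ← ENNReal.ofReal_pow hε.le]
  have : ENNReal.ofReal (2 ^ (n - 1)) * ENNReal.ofReal ε * (μ (ball 0 1) *
      ENNReal.ofReal ((1 / 4) ^ n) * ENNReal.ofReal (ε ^ (n - 1))) =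
      ENNReal.ofReal (2 ^ (n - 1) * ε * (1 / 4) ^ n * ε ^ (n - 1)) * μ (ball 0 1) := by
    rw [ENNReal.ofReal_mul (by positivity), ENNReal.ofReal_mul (by positivity),
      ENNReal.ofReal_mul (by positivity)]
    ring
  rw [this]
  gcongr
  obtain ⟨m, rfl⟩ : ∃ m, n = m + 1 := ⟨n - 1, by omega⟩
  simp only [Nat.add_sub_cancel]
  have h3 : (2 : ℝ) ^ m * ε * (1 / 4) ^ (m + 1) * ε ^ m = (ε / 2) ^ (m + 1) * (1 / 2) := by
    rw [div_pow, div_pow, show (4 : ℝ) = 2 * 2 by norm_num, mul_pow]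
    field_simp
    ring
  rw [h3]
  have : (0 : ℝ) ≤ (ε / 2) ^ (m + 1) := by positivity
  linarith

/-- On a compact metric space, a finite measure which is lower `d`-regular dominates a multiple of
the `d`-dimensional Hausdorff measure. -/
theorem hausdorffMeasure_le_of_le_measure_closedBall {X : Type*} [MetricSpace X] [CompactSpace X]
    [MeasurableSpace X] [BorelSpace X] (σ : Measure X) [IsFiniteMeasure σ] (d : ℕ) {c : ℝ≥0}
    (hc : 0 < c) (h : ∀ (x : X) (ε : ℝ), 0 < ε → ε ≤ 1 →
      (c : ℝ≥0∞) * ENNReal.ofReal ε ^ d ≤ σ (closedBall x ε)) :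
    (μH[(d : ℝ)] : Measure X) ≤ (8 ^ d / c : ℝ≥0∞) • σ := by
  have hc0 : (c : ℝ≥0∞) ≠ 0 := by simpa using hc.ne'
  have hct : (c : ℝ≥0∞) ≠ ∞ := ENNReal.coe_ne_top
  have hcomp : ∀ K : Set X, IsCompact K → μH[(d : ℝ)] K ≤ (8 ^ d / c : ℝ≥0∞) * σ K := by
    intro K hK
    let e : ℕ → ℝ := fun k => 1 / ((k : ℝ) + 1)
    have he0 : ∀ k, 0 < e k := fun k => by positivity
    have he1 : ∀ k, e k ≤ 1 := fun k => by
      have : (0 : ℝ) ≤ k := Nat.cast_nonneg k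
      simp only [e]
      rw [div_le_one (by positivity)]
      linarith
    have hetend : Filter.Tendsto e Filter.atTop (nhds 0) := tendsto_one_div_add_atTop_nhds_zero_nat
    have hV := fun k => Vitali.exists_disjoint_subfamily_covering_enlargement_closedBall K
      (fun x : X => x) (fun _ => e k) (e k) (fun _ _ => le_rfl) 4 (by norm_num)
    choose u huK hdisj hcov using hV
    have hpos : ∀ (x : X) k, 0 < σ (closedBall x (e k)) := fun x k =>
      lt_of_lt_of_le (by
        have := ENNReal.ofReal_pos.2 (he0 k)
        positivity) (h x (e k) (he0 k) (he1 k))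
    have hdisj' : ∀ k, Pairwise (Function.onFun Disjoint
        fun i : u k => closedBall (i : X) (e k)) := fun k i j hij =>
      hdisj k i.2 j.2 (fun h => hij (Subtype.ext h))
    have hcount : ∀ k, Countable (u k) := by
      intro k
      have := Measure.countable_meas_pos_of_disjoint_iUnion (μ := σ)
        (As := fun i : u k => closedBall (i : X) (e k))
        (fun i => measurableSet_closedBall) (hdisj' k)
      have h2 : {i : u k | 0 < σ (closedBall (i : X) (e k))} = Set.univ :=
        Set.eq_univ_of_forall fun i => hpos _ _
      rw [h2] at this
      exact Set.countable_univ_iff.1 this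
    have hr : Filter.Tendsto (fun k => ENNReal.ofReal (8 * e k)) Filter.atTop (nhds 0) := by
      have := ENNReal.tendsto_ofReal (hetend.const_mul 8)
      simpa using this
    have hdiam : ∀ (x : X) k, ediam (closedBall x (4 * e k)) ≤ ENNReal.ofReal (8 * e k) := by
      intro x k
      rw [← closedEBall_ofReal (by have := he0 k; positivity)]
      refine ediam_closedEBall_le.trans ?_
      rw [show 8 * e k = 2 * (4 * e k) by ring, ENNReal.ofReal_mul (p := 2) (by norm_num)]
      simp
    have hle := Measure.hausdorffMeasure_le_liminf_tsum (d : ℝ) K (l := Filter.atTop)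
      (fun k => ENNReal.ofReal (8 * e k)) hr
      (fun k (i : u k) => closedBall (i : X) (4 * e k))
      (Filter.Eventually.of_forall fun k i => hdiam _ _)
      (Filter.Eventually.of_forall fun k x hx => by
        obtain ⟨b, hb, hsub⟩ := hcov k x hx
        exact Set.mem_iUnion.2 ⟨⟨b, hb⟩, hsub (mem_closedBall_self (he0 k).le)⟩)
    refine hle.trans ?_
    have hbound : ∀ k, ∑' i : u k, ediam (closedBall (i : X) (4 * e k)) ^ (d : ℝ) ≤
        (8 ^ d / c : ℝ≥0∞) * σ (cthickening (e k) K) := by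
      intro k
      calc _ ≤ ∑' i : u k, (8 ^ d / c : ℝ≥0∞) * σ (closedBall (i : X) (e k)) := by
            refine ENNReal.tsum_le_tsum fun i => ?_
            rw [ENNReal.rpow_natCast]
            calc _ ≤ ENNReal.ofReal (8 * e k) ^ d := by gcongr; exact hdiam _ _
              _ = (8 ^ d / c : ℝ≥0∞) * (c * ENNReal.ofReal (e k) ^ d) := by
                rw [ENNReal.ofReal_mul (by norm_num), mul_pow, ← mul_assoc,
                  ENNReal.div_mul_cancel hc0 hct]
                simp
              _ ≤ _ := by gcongr; exact h _ _ (he0 k) (he1 k)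
        _ = (8 ^ d / c : ℝ≥0∞) * ∑' i : u k, σ (closedBall (i : X) (e k)) := ENNReal.tsum_mul_left
        _ ≤ _ := by
            gcongr
            refine (tsum_meas_le_meas_iUnion_of_disjoint σ (fun i => measurableSet_closedBall)
              (hdisj' k)).trans (measure_mono ?_)
            refine Set.iUnion_subset fun i => ?_
            exact closedBall_subset_cthickening (huK k i.2) _
    have hlim : Filter.Tendsto (fun k => (8 ^ d / c : ℝ≥0∞) * σ (cthickening (e k) K))
        Filter.atTop (nhds ((8 ^ d / c : ℝ≥0∞) * σ K)) := by
      refine ENNReal.Tendsto.const_mul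
        ((tendsto_measure_cthickening_of_isCompact hK).comp hetend) (Or.inr ?_)
      exact (ENNReal.div_lt_top (by simp) hc0).ne
    rw [← hlim.liminf_eq]
    exact Filter.liminf_le_liminf (Filter.Eventually.of_forall hbound)
  have hfin : IsFiniteMeasure (μH[(d : ℝ)] : Measure X) :=
    ⟨(hcomp _ isCompact_univ).trans_lt
      (ENNReal.mul_lt_top (ENNReal.div_lt_top (by simp) hc0) (measure_lt_top _ _))⟩
  refine Measure.le_iff.2 fun A hA => ?_
  rw [hA.measure_eq_iSup_isCompact]
  refine iSup₂_le fun K hKA => iSup_le fun hK => (hcomp K hK).trans ?_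
  rw [Measure.smul_apply, smul_eq_mul]
  gcongr

theorem sphere_lintegral_hausdorffMeasure_le {n : ℕ} (hn : 0 < n) :
    ∃ C : ℝ≥0, ∀ s : ℝ, 0 < s → ∀ f : EuclideanSpace ℝ (Fin n) → ℝ≥0∞, Measurable f →
      ∫⁻ x in sphere (0 : EuclideanSpace ℝ (Fin n)) s, f x ∂μH[(n : ℝ) - 1] ≤
        C * ENNReal.ofReal (s ^ (n - 1)) *
          ∫⁻ ω : sphere (0 : EuclideanSpace ℝ (Fin n)) 1, f (s • (ω : EuclideanSpace ℝ (Fin n)))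
            ∂(volume : Measure (EuclideanSpace ℝ (Fin n))).toSphere := by
  obtain ⟨c, hc, hball⟩ := toSphere_ball_ge hn
  have hle := hausdorffMeasure_le_of_le_measure_closedBall _ (n - 1) hc hball
  have hcast : (n : ℝ) - 1 = ((n - 1 : ℕ) : ℝ) := by rw [Nat.cast_sub hn]; simp
  rw [hcast]
  refine ⟨8 ^ (n - 1) / c, fun s hs f hf => ?_⟩
  let φ : sphere (0 : EuclideanSpace ℝ (Fin n)) 1 → EuclideanSpace ℝ (Fin n) := fun ω => s • ω.1
  have hφm : Measurable φ := by fun_prop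
  have hφL : LipschitzWith ⟨s, hs.le⟩ φ := by
    refine LipschitzWith.of_dist_le_mul fun a b => ?_
    simp only [φ, dist_smul₀, Real.norm_of_nonneg hs.le, Subtype.dist_eq]
    exact le_rfl
  have h1 : (μH[((n - 1 : ℕ) : ℝ)] : Measure (EuclideanSpace ℝ (Fin n))).restrict (sphere 0 s) ≤
      ENNReal.ofReal (s ^ (n - 1)) • (μH[((n - 1 : ℕ) : ℝ)]).map φ := by
    refine Measure.le_iff.2 fun A hA => ?_
    rw [Measure.restrict_apply hA, Measure.smul_apply, Measure.map_apply hφm hA, smul_eq_mul]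
    have hsub : A ∩ sphere 0 s ⊆ φ '' (φ ⁻¹' A) := by
      rintro x ⟨hxA, hxs⟩
      have hx : ‖x‖ = s := by simpa using hxs
      refine ⟨⟨s⁻¹ • x, ?_⟩, ?_, ?_⟩
      · simp [norm_smul, hx, abs_of_pos hs, inv_mul_cancel₀ hs.ne']
      · simpa [φ, smul_smul, mul_inv_cancel₀ hs.ne'] using hxA
      · simp [φ, smul_smul, mul_inv_cancel₀ hs.ne']
    refine (measure_mono hsub).trans
      ((hφL.hausdorffMeasure_image_le (Nat.cast_nonneg _) _).trans_eq ?_)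
    congr 1
    rw [ENNReal.rpow_natCast, ENNReal.ofReal_pow hs.le, ENNReal.ofReal,
      Real.toNNReal_of_nonneg hs.le]
    rfl
  refine (lintegral_mono' h1 le_rfl).trans ?_
  rw [lintegral_smul_measure, lintegral_map hf hφm, smul_eq_mul]
  calc _ ≤ ENNReal.ofReal (s ^ (n - 1)) * ∫⁻ ω, f (φ ω)
        ∂((8 ^ (n - 1) / c : ℝ≥0∞) • (volume : Measure (EuclideanSpace ℝ (Fin n))).toSphere) := by
        gcongr
    _ = _ := by
      rw [lintegral_smul_measure, smul_eq_mul, ENNReal.coe_div hc.ne']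
      push_cast
      ring

theorem hausdorffMeasure_sphere_inter_pos {n : ℕ} {s : ℝ} {x : EuclideanSpace ℝ (Fin n)}
    (hs : 0 < s)
    (hx : x ∈ sphere (0 : EuclideanSpace ℝ (Fin n)) s) {V : Set (EuclideanSpace ℝ (Fin n))}
    (hV : IsOpen V) (hxV : x ∈ V) :
    0 < μH[(n : ℝ) - 1] (sphere (0 : EuclideanSpace ℝ (Fin n)) s ∩ V) := by
  have hxn : ‖x‖ = s := by simpa using hx
  have hx0 : x ≠ 0 := by rintro rfl; simp at hxn; exact hs.ne hxn
  obtain ⟨j, hj⟩ : ∃ j, x j ≠ 0 := by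
    by_contra! h
    exact hx0 (by ext i; simpa using h i)
  obtain ⟨m, rfl⟩ : ∃ m, n = m + 1 := ⟨n - 1, by have := j.pos; omega⟩
  have hcast : ((m + 1 : ℕ) : ℝ) - 1 = m := by simp
  rw [hcast]
  have hxsq : x j ^ 2 + ∑ i, x (j.succAbove i) ^ 2 = s ^ 2 := by
    rw [← hxn, EuclideanSpace.real_norm_sq_eq, Fin.sum_univ_succAbove _ j]
  let π : EuclideanSpace ℝ (Fin (m + 1)) → (Fin m → ℝ) := fun y i => y (j.succAbove i)
  have hπ : LipschitzWith 1 π := by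
    refine LipschitzWith.of_dist_le_mul fun a b => ?_
    rw [NNReal.coe_one, one_mul]
    refine (dist_pi_le_iff dist_nonneg).2 fun i => ?_
    rw [dist_eq_norm, dist_eq_norm]
    exact PiLp.norm_apply_le (a - b) (j.succAbove i)
  let σ : ℝ := x j / |x j|
  have hσ : σ ^ 2 = 1 := by
    simp only [σ, div_pow, sq_abs]
    field_simp
  let g : (Fin m → ℝ) → EuclideanSpace ℝ (Fin (m + 1)) := fun y =>
    WithLp.toLp 2 (j.insertNth (α := fun _ => ℝ) (σ * Real.sqrt (s ^ 2 - ∑ i, y i ^ 2)) y)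
  have hg : Continuous g := by
    refine (PiLp.continuous_toLp 2 _).comp ?_
    refine Continuous.finInsertNth j ?_ continuous_id
    fun_prop
  have hgx : g (π x) = x := by
    have h1 : σ * Real.sqrt (s ^ 2 - ∑ i, x (j.succAbove i) ^ 2) = x j := by
      rw [show s ^ 2 - ∑ i, x (j.succAbove i) ^ 2 = x j ^ 2 by linarith, Real.sqrt_sq_eq_abs]
      simp only [σ]
      field_simp
    ext i
    simp only [g, π]
    refine Fin.succAboveCases j ?_ (fun i => ?_) i
    · simp [h1]
    · simp
  let W : Set (Fin m → ℝ) := {y | ∑ i, y i ^ 2 < s ^ 2} ∩ g ⁻¹' V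
  have hW : IsOpen W := (isOpen_lt (by fun_prop) (by fun_prop)).inter (hV.preimage hg)
  have hxW : π x ∈ W := by
    refine ⟨?_, by simpa [hgx] using hxV⟩
    have := pow_pos (abs_pos.2 hj) 2
    rw [sq_abs] at this
    simp only [Set.mem_ofPred_eq, π]
    linarith
  have hsub : W ⊆ π '' (sphere (0 : EuclideanSpace ℝ (Fin (m + 1))) s ∩ V) := by
    rintro y ⟨hy1, hy2⟩
    refine ⟨g y, ⟨?_, hy2⟩, ?_⟩
    · rw [mem_sphere_zero_iff_norm, ← sq_eq_sq₀ (norm_nonneg _) hs.le,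
        EuclideanSpace.real_norm_sq_eq, Fin.sum_univ_succAbove _ j]
      simp only [g, Fin.insertNth_apply_same, Fin.insertNth_apply_succAbove, mul_pow, hσ]
      rw [Real.sq_sqrt (by simpa using (le_of_lt hy1))]
      ring
    · ext i
      simp [π, g]
  have hvol : (μH[(m : ℝ)] : Measure (Fin m → ℝ)) = volume := by
    have := hausdorffMeasure_pi_real (ι := Fin m)
    simpa using this
  have h1 := hπ.hausdorffMeasure_image_le (Nat.cast_nonneg m)
    (sphere (0 : EuclideanSpace ℝ (Fin (m + 1))) s ∩ V)
  rw [hvol] at h1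
  have h2 : 0 < volume W := hW.measure_pos _ ⟨_, hxW⟩
  simpa using h2.trans_le ((measure_mono hsub).trans h1)

open scoped ContDiff

/-- The derivative of `f` in the direction `e`. -/
def dirDeriv {n : ℕ} (e : EuclideanSpace ℝ (Fin n)) (f : EuclideanSpace ℝ (Fin n) → ℝ) :
    EuclideanSpace ℝ (Fin n) → ℝ :=
  fun x => fderiv ℝ f x e

/-- The Laplacian of `u`. -/
def lapl {n : ℕ} (u : EuclideanSpace ℝ (Fin n) → ℝ) : EuclideanSpace ℝ (Fin n) → ℝ :=
  fun x => ∑ i, pd i (pd i u) x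

section Derivatives

variable {n : ℕ} {f g : EuclideanSpace ℝ (Fin n) → ℝ}

theorem contDiff_dirDeriv (hf : ContDiff ℝ ∞ f) (e : EuclideanSpace ℝ (Fin n)) :
    ContDiff ℝ ∞ (dirDeriv e f) :=
  (hf.fderiv_right (m := ∞) (by simp)).clm_apply contDiff_const

theorem contDiff_pd (hf : ContDiff ℝ ∞ f) (i : Fin n) : ContDiff ℝ ∞ (pd i f) :=
  contDiff_dirDeriv hf _

theorem dirDeriv_comm (hf : ContDiff ℝ ∞ f) (a b : EuclideanSpace ℝ (Fin n)) :
    dirDeriv a (dirDeriv b f) = dirDeriv b (dirDeriv a f) := by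
  have hd : Differentiable ℝ (fderiv ℝ f) :=
    (hf.fderiv_right (m := ∞) (by simp)).differentiable (by simp)
  have key : ∀ (a b x : EuclideanSpace ℝ (Fin n)),
      dirDeriv a (dirDeriv b f) x = fderiv ℝ (fderiv ℝ f) x a b := by
    intro a b x
    have := (hd x).hasFDerivAt.clm_apply (hasFDerivAt_const b x)
    change fderiv ℝ (fun y => fderiv ℝ f y b) x a = _
    rw [this.fderiv]
    simp
  funext x
  rw [key, key]
  exact (hf.contDiffAt.isSymmSndFDerivAt (by
    rw [minSmoothness_of_isRCLikeNormedField]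
    exact WithTop.coe_le_coe.2 (le_top : (2 : ℕ∞) ≤ ⊤))) a b

theorem pd_comm (hf : ContDiff ℝ ∞ f) (i j : Fin n) : pd i (pd j f) = pd j (pd i f) :=
  dirDeriv_comm hf _ _

theorem fderiv_apply_eq_sum_pd (f : EuclideanSpace ℝ (Fin n) → ℝ) (x e : EuclideanSpace ℝ (Fin n)) :
    fderiv ℝ f x e = ∑ i, e i * pd i f x := by
  conv_lhs => rw [← (EuclideanSpace.basisFun (Fin n) ℝ).sum_repr e]
  simp [pd]

theorem dirDeriv_eq_sum_pd (f : EuclideanSpace ℝ (Fin n) → ℝ) (e : EuclideanSpace ℝ (Fin n)) :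
    dirDeriv e f = fun x => ∑ i, e i * pd i f x :=
  funext fun x => fderiv_apply_eq_sum_pd f x e

theorem pd_sum_smul {ι : Type*} (s : Finset ι) (c : ι → ℝ) (F : ι → EuclideanSpace ℝ (Fin n) → ℝ)
    (hF : ∀ k, ContDiff ℝ ∞ (F k)) (i : Fin n) :
    pd i (fun x => ∑ k ∈ s, c k * F k x) = fun x => ∑ k ∈ s, c k * pd i (F k) x := by
  funext x
  have : HasFDerivAt (fun x => ∑ k ∈ s, c k * F k x) (∑ k ∈ s, c k • fderiv ℝ (F k) x) x :=
    HasFDerivAt.fun_sum fun k _ => (((hF k).differentiable (by simp) x).hasFDerivAt).const_mul (c k)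
  simp [pd, this.fderiv]

theorem contDiff_foldr_pd (hf : ContDiff ℝ ∞ f) (l : List (Fin n)) :
    ContDiff ℝ ∞ (l.foldr pd f) := by
  induction l with
  | nil => exact hf
  | cons i l ih => exact contDiff_pd ih i

theorem foldr_pd_perm (hf : ContDiff ℝ ∞ f) {l₁ l₂ : List (Fin n)} (h : l₁.Perm l₂) :
    l₁.foldr pd f = l₂.foldr pd f := by
  induction h with
  | nil => rfl
  | cons x _ ih => simp only [List.foldr_cons, ih]
  | swap x y l => exact pd_comm (contDiff_foldr_pd hf l) y x
  | trans _ _ ih₁ ih₂ => exact ih₁.trans ih₂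

theorem foldr_pd_sum_smul {ι : Type*} (s : Finset ι) (c : ι → ℝ)
    (F : ι → EuclideanSpace ℝ (Fin n) → ℝ) (hF : ∀ k, ContDiff ℝ ∞ (F k)) (l : List (Fin n)) :
    l.foldr pd (fun x => ∑ k ∈ s, c k * F k x) = fun x => ∑ k ∈ s, c k * l.foldr pd (F k) x := by
  induction l with
  | nil => rfl
  | cons i l ih =>
    simp only [List.foldr_cons, ih]
    exact pd_sum_smul s c _ (fun k => contDiff_foldr_pd (hF k) l) i

theorem foldr_pd_eq_mderiv (hf : ContDiff ℝ ∞ f) (l : List (Fin n)) :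
    l.foldr pd f = mderiv (fun i => l.count i) f := by
  have h1 : ∀ (α : Fin n → ℕ) (l' : List (Fin n)),
      l'.foldr (fun i v => (pd i)^[α i] v) f =
        (l'.flatMap fun i => List.replicate (α i) i).foldr pd f := by
    intro α l'
    induction l' with
    | nil => rfl
    | cons i l' ih =>
      simp only [List.foldr_cons, List.flatMap_cons, List.foldr_append, ih]
      generalize (List.flatMap (fun i => List.replicate (α i) i) l').foldr pd f = g
      induction α i with
      | zero => rfl
      | succ k ihk => rw [Function.iterate_succ_apply', ihk, List.replicate_succ, List.foldr_cons]
  rw [mderiv, h1]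
  refine foldr_pd_perm hf (List.perm_iff_count.2 fun i => ?_)
  rw [List.count_flatMap]
  have : ((List.finRange n).map (List.count i ∘ fun j => List.replicate (l.count j) j)) =
      (List.finRange n).map (fun j => if j = i then l.count j else 0) := by
    refine List.map_congr_left fun j _ => ?_
    simp [List.count_replicate]
  rw [this, ← List.ofFn_eq_map, List.sum_ofFn]
  simp

theorem abs_iterate_dirDeriv_le (e : EuclideanSpace ℝ (Fin n)) {B : ℝ}
    (y : EuclideanSpace ℝ (Fin n)) (m : ℕ) (hf : ContDiff ℝ ∞ f)
    (hB : ∀ l : List (Fin n), l.length = m → |l.foldr pd f y| ≤ B) :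
    |(dirDeriv e)^[m] f y| ≤ (n * ‖e‖) ^ m * B := by
  induction m generalizing f B with
  | zero => simpa using hB [] rfl
  | succ m ih =>
    have hB0 : ∀ l : List (Fin n), l.length = m →
        |l.foldr pd (dirDeriv e f) y| ≤ n * ‖e‖ * B := by
      intro l hl
      rw [dirDeriv_eq_sum_pd, foldr_pd_sum_smul _ _ _ (fun i => contDiff_pd hf i)]
      refine (Finset.abs_sum_le_sum_abs _ _).trans ?_
      have : ∀ i ∈ Finset.univ, |e i * l.foldr pd (pd i f) y| ≤ ‖e‖ * B := by
        intro i _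
        rw [abs_mul]
        have h1 := hB (l ++ [i]) (by simp [hl])
        rw [List.foldr_append] at h1
        have h2 : |e i| ≤ ‖e‖ := PiLp.norm_apply_le e i
        exact mul_le_mul h2 h1 (abs_nonneg _) (norm_nonneg _)
      refine (Finset.sum_le_sum this).trans ?_
      simp [mul_assoc]
    rw [Function.iterate_succ_apply]
    refine (ih (contDiff_dirDeriv hf e) hB0).trans_eq ?_
    ring

theorem lapl_dirDeriv (hf : ContDiff ℝ ∞ f) (e : EuclideanSpace ℝ (Fin n)) :
    lapl (dirDeriv e f) = dirDeriv e (lapl f) := by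
  have h1 : ∀ i, pd i (pd i (dirDeriv e f)) = dirDeriv e (pd i (pd i f)) := fun i => by
    rw [show pd i (dirDeriv e f) = dirDeriv e (pd i f) from dirDeriv_comm hf _ _]
    exact dirDeriv_comm (contDiff_pd hf i) _ _
  funext x
  have : HasFDerivAt (lapl f) (∑ i, fderiv ℝ (pd i (pd i f)) x) x :=
    HasFDerivAt.fun_sum fun i _ =>
      ((contDiff_pd (contDiff_pd hf i) i).differentiable (by simp) x).hasFDerivAt
  simp only [lapl, h1]
  rw [dirDeriv, this.fderiv]
  simp [dirDeriv]

theorem lapl_dirDeriv_eq_zero (hf : ContDiff ℝ ∞ f) {R : ℝ}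
    (h : ∀ x ∈ ball (0 : EuclideanSpace ℝ (Fin n)) R, lapl f x = 0) (e : EuclideanSpace ℝ (Fin n)) :
    ∀ x ∈ ball (0 : EuclideanSpace ℝ (Fin n)) R, lapl (dirDeriv e f) x = 0 := by
  intro x hx
  rw [lapl_dirDeriv hf, dirDeriv]
  have : lapl f =ᶠ[nhds x] fun _ => 0 := by
    filter_upwards [isOpen_ball.mem_nhds hx] with y hy using h y hy
  rw [this.fderiv_eq]
  simp

theorem lapl_sq (hf : ContDiff ℝ ∞ f) (x : EuclideanSpace ℝ (Fin n)) :
    lapl (fun y => f y ^ 2) x = 2 * f x * lapl f x + 2 * ∑ i, pd i f x ^ 2 := by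
  have hd : ∀ {g : EuclideanSpace ℝ (Fin n) → ℝ}, ContDiff ℝ ∞ g →
      ∀ y, HasFDerivAt g (fderiv ℝ g y) y :=
    fun hg y => (hg.differentiable (by simp) y).hasFDerivAt
  have h1 : ∀ i, pd i (fun y => f y ^ 2) = fun y => 2 * f y * pd i f y := by
    intro i
    funext y
    rw [pd, ((hd hf y).pow 2).fderiv]
    simp [pd]
  have h2 : ∀ i, pd i (fun y => 2 * f y * pd i f y) x =
      2 * f x * pd i (pd i f) x + 2 * pd i f x ^ 2 := by
    intro i
    have := ((hd hf x).const_mul 2).fun_mul (hd (contDiff_pd hf i) x)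
    rw [pd, this.fderiv]
    simp [pd]
    ring
  simp only [lapl, h1, h2, Finset.sum_add_distrib, Finset.mul_sum]

end Derivatives

/-- A smooth function on `ℝ`, positive on `(-∞, 1)` and zero on `[1, ∞)`. -/
def cutF (t : ℝ) : ℝ := expNegInvGlue (1 - t)

/-- Minus the derivative of `cutF`. -/
def cutQ (t : ℝ) : ℝ := ((1 - t)⁻¹) ^ 2 * expNegInvGlue (1 - t)

/-- The radial bump `y ↦ cutF (‖y‖²)`, supported in the closed unit ball. -/
def bumpF (n : ℕ) (y : EuclideanSpace ℝ (Fin n)) : ℝ := cutF (‖y‖ ^ 2)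

/-- The radial bump `y ↦ cutQ (‖y‖²)`, supported in the closed unit ball. -/
def bumpQ (n : ℕ) (y : EuclideanSpace ℝ (Fin n)) : ℝ := cutQ (‖y‖ ^ 2)

section Bumps

variable {n : ℕ}

theorem cutF_nonneg (t : ℝ) : 0 ≤ cutF t := expNegInvGlue.nonneg _

theorem cutQ_nonneg (t : ℝ) : 0 ≤ cutQ t := mul_nonneg (sq_nonneg _) (expNegInvGlue.nonneg _)

theorem cutF_eq_zero {t : ℝ} (ht : 1 ≤ t) : cutF t = 0 :=
  expNegInvGlue.zero_of_nonpos (by linarith)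

theorem cutQ_eq_zero {t : ℝ} (ht : 1 ≤ t) : cutQ t = 0 := by
  rw [cutQ, expNegInvGlue.zero_of_nonpos (by linarith), mul_zero]

theorem cutQ_pos {t : ℝ} (ht : t < 1) : 0 < cutQ t := by
  have h : 0 < 1 - t := by linarith
  exact mul_pos (pow_pos (inv_pos.2 h) 2) (expNegInvGlue.pos_of_pos h)

theorem hasDerivAt_cutF (t : ℝ) : HasDerivAt cutF (-cutQ t) t := by
  have h1 := expNegInvGlue.hasDerivAt_polynomial_eval_inv_mul 1 (1 - t)
  have h2 := h1.comp t ((hasDerivAt_id t).const_sub 1)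
  have h3 : HasDerivAt (fun t => expNegInvGlue (1 - t)) (-cutQ t) t := by
    simpa [cutQ, Function.comp_def] using h2
  exact h3

theorem contDiff_cutF : ContDiff ℝ ∞ cutF :=
  expNegInvGlue.contDiff.comp (contDiff_const.sub contDiff_id)

theorem contDiff_cutQ : ContDiff ℝ ∞ cutQ := by
  have h := (expNegInvGlue.contDiff_polynomial_eval_inv_mul (n := ⊤) (Polynomial.X ^ 2)).comp
    (contDiff_const.sub contDiff_id : ContDiff ℝ ∞ fun t : ℝ => 1 - t)
  have h' : ContDiff ℝ ∞ fun t => ((1 - t)⁻¹) ^ 2 * expNegInvGlue (1 - t) := by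
    simpa [Function.comp_def] using h
  exact h'

theorem contDiff_bumpF : ContDiff ℝ ∞ (bumpF n) := contDiff_cutF.comp (contDiff_norm_sq ℝ)

theorem contDiff_bumpQ : ContDiff ℝ ∞ (bumpQ n) := contDiff_cutQ.comp (contDiff_norm_sq ℝ)

theorem bumpF_nonneg (y : EuclideanSpace ℝ (Fin n)) : 0 ≤ bumpF n y := cutF_nonneg _

theorem bumpQ_nonneg (y : EuclideanSpace ℝ (Fin n)) : 0 ≤ bumpQ n y := cutQ_nonneg _

theorem bumpF_eq_zero {y : EuclideanSpace ℝ (Fin n)} (hy : 1 ≤ ‖y‖) : bumpF n y = 0 :=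
  cutF_eq_zero (one_le_pow₀ hy)

theorem bumpQ_eq_zero {y : EuclideanSpace ℝ (Fin n)} (hy : 1 ≤ ‖y‖) : bumpQ n y = 0 :=
  cutQ_eq_zero (one_le_pow₀ hy)

theorem hasCompactSupport_bumpF : HasCompactSupport (bumpF n) :=
  HasCompactSupport.intro (isCompact_closedBall 0 1) fun y hy =>
    bumpF_eq_zero (by simpa using (not_le.1 (mt mem_closedBall.2 hy)).le)

theorem hasCompactSupport_bumpQ : HasCompactSupport (bumpQ n) :=
  HasCompactSupport.intro (isCompact_closedBall 0 1) fun y hy =>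
    bumpQ_eq_zero (by simpa using (not_le.1 (mt mem_closedBall.2 hy)).le)

theorem pd_bumpF (i : Fin n) (y : EuclideanSpace ℝ (Fin n)) :
    pd i (bumpF n) y = -2 * (bumpQ n y * y i) := by
  have h := (hasDerivAt_cutF (‖y‖ ^ 2)).comp_hasFDerivAt y
    (hasStrictFDerivAt_norm_sq y).hasFDerivAt
  have h' : HasFDerivAt (bumpF n) _ y := h
  rw [pd, h'.fderiv]
  simp [bumpQ, EuclideanSpace.inner_single_right]
  ring

theorem integral_bumpQ_pos : 0 < ∫ y, bumpQ n y := by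
  refine (contDiff_bumpQ.continuous).integral_pos_of_hasCompactSupport_nonneg_nonzero
    hasCompactSupport_bumpQ bumpQ_nonneg (x := 0) ?_
  simpa [bumpQ] using (cutQ_pos zero_lt_one).ne'

theorem integral_mul_pd {φ w : EuclideanSpace ℝ (Fin n) → ℝ} (hφ : ContDiff ℝ ∞ φ)
    (hw : ContDiff ℝ ∞ w) (hc : HasCompactSupport φ) (i : Fin n) :
    ∫ y, φ y * pd i w y = -∫ y, pd i φ y * w y := by
  have hc' : HasCompactSupport (pd i φ) := (hc.fderiv (𝕜 := ℝ)).mono fun y hy => by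
    contrapose! hy
    simp only [Function.mem_support, not_not] at hy
    simp [pd, hy]
  refine integral_mul_fderiv_eq_neg_fderiv_mul_of_integrable ?_ ?_ ?_
    (fun x _ => hφ.differentiable (by simp) x) (fun x _ => hw.differentiable (by simp) x)
  · exact ((contDiff_pd hφ i).continuous.mul hw.continuous).integrable_of_hasCompactSupport
      hc'.mul_right
  · exact (hφ.continuous.mul (contDiff_pd hw i).continuous).integrable_of_hasCompactSupport
      hc.mul_right
  · exact (hφ.continuous.mul hw.continuous).integrable_of_hasCompactSupport hc.mul_right

theorem pd_comp_add_smul {v : EuclideanSpace ℝ (Fin n) → ℝ} (hv : ContDiff ℝ ∞ v)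
    (x : EuclideanSpace ℝ (Fin n)) (t : ℝ) (i : Fin n) :
    pd i (fun y => v (x + t • y)) = fun y => t * pd i v (x + t • y) := by
  funext y
  have h : HasFDerivAt (fun y => v (x + t • y)) _ y :=
    ((hv.differentiable (by simp) (x + t • y)).hasFDerivAt).comp y
      (((hasFDerivAt_id y).const_smul t).const_add x)
  rw [pd, h.fderiv]
  simp [pd]

theorem contDiff_comp_add_smul {v : EuclideanSpace ℝ (Fin n) → ℝ} (hv : ContDiff ℝ ∞ v)
    (x : EuclideanSpace ℝ (Fin n)) (t : ℝ) : ContDiff ℝ ∞ fun y => v (x + t • y) :=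
  hv.comp (contDiff_const.add (contDiff_id.const_smul t))

theorem integral_bumpQ_mul_fderiv {v : EuclideanSpace ℝ (Fin n) → ℝ} (hv : ContDiff ℝ ∞ v)
    (x : EuclideanSpace ℝ (Fin n)) (t : ℝ) :
    ∫ y, bumpQ n y * fderiv ℝ v (x + t • y) y =
      t / 2 * ∫ y, bumpF n y * lapl v (x + t • y) := by
  have h1 : ∀ y, bumpQ n y * fderiv ℝ v (x + t • y) y =
      ∑ i, -2⁻¹ * (pd i (bumpF n) y * pd i v (x + t • y)) := by
    intro y
    rw [fderiv_apply_eq_sum_pd, Finset.mul_sum]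
    refine Finset.sum_congr rfl fun i _ => ?_
    rw [pd_bumpF]; ring
  have hw : ∀ i, ContDiff ℝ ∞ fun y => pd i v (x + t • y) := fun i =>
    contDiff_comp_add_smul (contDiff_pd hv i) x t
  have hc' : ∀ i, HasCompactSupport (pd i (bumpF n)) := fun i =>
    (hasCompactSupport_bumpF.fderiv (𝕜 := ℝ)).mono fun y hy => by
      contrapose! hy
      simp only [Function.mem_support, not_not] at hy
      simp [pd, hy]
  have h2 : ∀ i, ∫ y, pd i (bumpF n) y * pd i v (x + t • y) =
      -(t * ∫ y, bumpF n y * pd i (pd i v) (x + t • y)) := by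
    intro i
    have := integral_mul_pd contDiff_bumpF (hw i) hasCompactSupport_bumpF i
    rw [pd_comp_add_smul (contDiff_pd hv i)] at this
    rw [eq_neg_iff_add_eq_zero, ← integral_const_mul, add_comm, ← eq_neg_iff_add_eq_zero, ← this]
    congr 1; ext y; ring
  simp_rw [h1]
  rw [integral_finsetSum]
  · simp_rw [integral_const_mul, h2, lapl, Finset.mul_sum]
    rw [integral_finsetSum, Finset.mul_sum]
    · refine Finset.sum_congr rfl fun i _ => ?_
      ring
    · intro i _
      exact (contDiff_bumpF.continuous.mul (contDiff_comp_add_smul (contDiff_pd (contDiff_pd hv i) i)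
        x t).continuous).integrable_of_hasCompactSupport hasCompactSupport_bumpF.mul_right
  · intro i _
    exact (((contDiff_pd contDiff_bumpF i).continuous.mul
      (hw i).continuous).integrable_of_hasCompactSupport (hc' i).mul_right).const_mul _

theorem hasDerivAt_integral_mul_comp {φ v : EuclideanSpace ℝ (Fin n) → ℝ} (hφ : Continuous φ)
    (hc : HasCompactSupport φ) (hv : ContDiff ℝ ∞ v) (x : EuclideanSpace ℝ (Fin n)) (t : ℝ) :
    HasDerivAt (fun t : ℝ => ∫ y, φ y * v (x + t • y))
      (∫ y, φ y * fderiv ℝ v (x + t • y) y) t := by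
  have hv' : Continuous (fderiv ℝ v) := (hv.continuous_fderiv (by simp))
  have hcont : Continuous fun p : ℝ × EuclideanSpace ℝ (Fin n) =>
      fderiv ℝ v (x + p.1 • p.2) p.2 := by fun_prop
  obtain ⟨K, hK⟩ := ((isCompact_closedBall t 1).prod hc).exists_bound_of_continuousOn
    hcont.continuousOn
  refine (hasDerivAt_integral_of_dominated_loc_of_deriv_le (ball_mem_nhds t one_pos)
    (μ := volume)
    (F := fun (s : ℝ) y => φ y * v (x + s • y))
    (F' := fun (s : ℝ) y => φ y * fderiv ℝ v (x + s • y) y)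
    (bound := fun y => ‖φ y‖ * K) ?_ ?_ ?_ ?_ ?_ ?_).2
  · exact Filter.Eventually.of_forall fun s =>
      (hφ.mul (contDiff_comp_add_smul hv x s).continuous).aestronglyMeasurable
  · exact (hφ.mul (contDiff_comp_add_smul hv x t).continuous).integrable_of_hasCompactSupport
      hc.mul_right
  · have : Continuous fun y => φ y * fderiv ℝ v (x + t • y) y :=
      hφ.mul (hcont.comp (Continuous.prodMk_right t))
    exact this.aestronglyMeasurable
  · refine Filter.Eventually.of_forall fun y s hs => ?_
    rw [norm_mul]
    by_cases hy : y ∈ tsupport φ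
    · exact mul_le_mul_of_nonneg_left (hK (s, y) ⟨ball_subset_closedBall hs, hy⟩) (norm_nonneg _)
    · simp [image_eq_zero_of_notMem_tsupport hy]
  · exact (hφ.norm.integrable_of_hasCompactSupport hc.norm).mul_const K
  · refine Filter.Eventually.of_forall fun y s _ => ?_
    have h1 : HasDerivAt (fun s : ℝ => x + s • y) y s := by
      simpa using ((hasDerivAt_id s).smul_const y).const_add x
    exact ((hv.differentiable (by simp) _).hasFDerivAt.comp_hasDerivAt s h1).const_mul _

theorem mean_value_bumpQ {v : EuclideanSpace ℝ (Fin n) → ℝ} (hv : ContDiff ℝ ∞ v) {R : ℝ}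
    (h : ∀ x ∈ ball (0 : EuclideanSpace ℝ (Fin n)) R, lapl v x = 0)
    {x : EuclideanSpace ℝ (Fin n)} {δ : ℝ} (hδ : 0 ≤ δ) (hx : ‖x‖ + δ ≤ R) :
    ∫ y, bumpQ n y * v (x + δ • y) = (∫ y, bumpQ n y) * v x := by
  have hd := hasDerivAt_integral_mul_comp contDiff_bumpQ.continuous hasCompactSupport_bumpQ hv x
  have hconst := constant_of_has_deriv_right_zero (a := 0) (b := δ)
    (f := fun t : ℝ => ∫ y, bumpQ n y * v (x + t • y))
    (fun t _ => (hd t).continuousAt.continuousWithinAt) (fun t ht => by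
      have h0 : ∫ y, bumpQ n y * fderiv ℝ v (x + t • y) y = 0 := by
        rw [integral_bumpQ_mul_fderiv hv]
        have : ∀ y, bumpF n y * lapl v (x + t • y) = 0 := by
          intro y
          by_cases hy : 1 ≤ ‖y‖
          · rw [bumpF_eq_zero hy, zero_mul]
          · rw [h, mul_zero]
            rw [mem_ball_zero_iff]
            have h1 : ‖t • y‖ ≤ t := by
              rw [norm_smul, Real.norm_of_nonneg ht.1]
              exact mul_le_of_le_one_right ht.1 (not_le.1 hy).le
            linarith [norm_add_le x (t • y), ht.2]
        simp [this]
      exact h0 ▸ (hd t).hasDerivWithinAt) δ ⟨hδ, le_rfl⟩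
  simpa [integral_mul_const] using hconst

end Bumps

section Estimates

variable {n : ℕ}

theorem exists_abs_pd_le (n : ℕ) : ∃ K : ℝ, 0 ≤ K ∧
    ∀ v : EuclideanSpace ℝ (Fin n) → ℝ, ContDiff ℝ ∞ v → ∀ R : ℝ,
      (∀ x ∈ ball (0 : EuclideanSpace ℝ (Fin n)) R, lapl v x = 0) →
      ∀ (x : EuclideanSpace ℝ (Fin n)) (δ A : ℝ), 0 < δ → ‖x‖ + δ ≤ R →
        (∀ y, ‖y‖ ≤ ‖x‖ + δ → |v y| ≤ A) → ∀ i, |pd i v x| ≤ K / δ * A := by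
  set Q := ∫ y, bumpQ n y with hQ
  have hQ0 : 0 < Q := integral_bumpQ_pos
  have hc : ∀ i, HasCompactSupport (pd i (bumpQ n)) := fun i =>
    (hasCompactSupport_bumpQ.fderiv (𝕜 := ℝ)).mono fun y hy => by
      contrapose! hy
      simp only [Function.mem_support, not_not] at hy
      simp [pd, hy]
  have hI : ∀ i, Integrable (fun y => |pd i (bumpQ n) y|) := fun i =>
    ((contDiff_pd contDiff_bumpQ i).continuous.integrable_of_hasCompactSupport (hc i)).abs
  have hK0 : ∀ i, 0 ≤ ∫ y, |pd i (bumpQ n) y| := fun i => integral_nonneg fun _ => abs_nonneg _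
  refine ⟨(∑ i, ∫ y, |pd i (bumpQ n) y|) / Q, div_nonneg (Finset.sum_nonneg fun i _ => hK0 i) hQ0.le,
    fun v hv R hR x δ A hδ hx hA i => ?_⟩
  have h1 : δ * (Q * pd i v x) = -∫ y, pd i (bumpQ n) y * v (x + δ • y) := by
    rw [← mean_value_bumpQ (contDiff_pd hv i) (lapl_dirDeriv_eq_zero hv hR _) hδ.le hx,
      ← integral_mul_pd contDiff_bumpQ (contDiff_comp_add_smul hv x δ) hasCompactSupport_bumpQ,
      pd_comp_add_smul hv, ← integral_const_mul]
    congr 1; ext y; ring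
  have h2 : |∫ y, pd i (bumpQ n) y * v (x + δ • y)| ≤ (∫ y, |pd i (bumpQ n) y|) * A := by
    rw [← integral_mul_const, ← Real.norm_eq_abs]
    refine norm_integral_le_of_norm_le ((hI i).mul_const A) (Filter.Eventually.of_forall fun y => ?_)
    rw [norm_mul, Real.norm_eq_abs, Real.norm_eq_abs]
    by_cases hy : y ∈ tsupport (pd i (bumpQ n))
    · refine mul_le_mul_of_nonneg_left (hA _ ?_) (abs_nonneg _)
      have hy' : ‖y‖ ≤ 1 := by
        have hsub : tsupport (pd i (bumpQ n)) ⊆ closedBall 0 1 := by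
          refine (closure_mono ?_ : _ ⊆ tsupport (fderiv ℝ (bumpQ n))).trans
            ((tsupport_fderiv_subset ℝ).trans (closure_minimal ?_ isClosed_closedBall))
          · intro z hz
            contrapose! hz
            simp only [Function.mem_support, not_not] at hz
            simp [pd, hz]
          · intro z hz
            contrapose! hz
            simp [bumpQ_eq_zero (by simpa using (not_le.1 (mt mem_closedBall.2 hz)).le :
              1 ≤ ‖z‖)]
        simpa using hsub hy
      refine (norm_add_le _ _).trans ?_
      rw [norm_smul, Real.norm_of_nonneg hδ.le]
      gcongr
      exact mul_le_of_le_one_right hδ.le hy'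
    · simp [image_eq_zero_of_notMem_tsupport hy]
  have hA0 : 0 ≤ A := (abs_nonneg _).trans (hA x (by linarith))
  have h3 : δ * (Q * |pd i v x|) ≤ (∑ i, ∫ y, |pd i (bumpQ n) y|) * A := by
    calc δ * (Q * |pd i v x|) = |δ * (Q * pd i v x)| := by
          rw [abs_mul, abs_mul, abs_of_pos hδ, abs_of_pos hQ0]
      _ ≤ _ := by
          rw [h1, abs_neg]
          refine h2.trans (mul_le_mul_of_nonneg_right ?_ hA0)
          exact Finset.single_le_sum (f := fun i => ∫ y, |pd i (bumpQ n) y|)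
            (fun i _ => hK0 i) (Finset.mem_univ i)
  rw [div_div, div_mul_eq_mul_div, le_div_iff₀ (mul_pos hQ0 hδ)]
  linarith

theorem lapl_foldr_pd_eq_zero {f : EuclideanSpace ℝ (Fin n) → ℝ} (hf : ContDiff ℝ ∞ f) {R : ℝ}
    (h : ∀ x ∈ ball (0 : EuclideanSpace ℝ (Fin n)) R, lapl f x = 0) (l : List (Fin n)) :
    ∀ x ∈ ball (0 : EuclideanSpace ℝ (Fin n)) R, lapl (l.foldr pd f) x = 0 := by
  induction l with
  | nil => exact h
  | cons i l ih => exact lapl_dirDeriv_eq_zero (contDiff_foldr_pd hf l) ih _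

theorem exists_abs_foldr_pd_le (n : ℕ) : ∃ K : ℝ, 0 ≤ K ∧
    ∀ v : EuclideanSpace ℝ (Fin n) → ℝ, ContDiff ℝ ∞ v → ∀ R : ℝ,
      (∀ x ∈ ball (0 : EuclideanSpace ℝ (Fin n)) R, lapl v x = 0) →
      ∀ (δ A r : ℝ), 0 < δ → r ≤ R → (∀ y, ‖y‖ ≤ r → |v y| ≤ A) →
      ∀ (l : List (Fin n)) (x : EuclideanSpace ℝ (Fin n)), ‖x‖ + l.length * δ ≤ r →
        |l.foldr pd v x| ≤ (K / δ) ^ l.length * A := by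
  obtain ⟨K, hK, h⟩ := exists_abs_pd_le n
  refine ⟨K, hK, fun v hv R hR δ A r hδ hr hA l => ?_⟩
  induction l with
  | nil => intro x hx; simpa using hA x (by simpa using hx)
  | cons i l ih =>
    intro x hx
    simp only [List.length_cons, Nat.cast_add, Nat.cast_one] at hx
    have hl : 0 ≤ l.length * δ := by positivity
    simp only [List.foldr_cons, List.length_cons, pow_succ', mul_assoc]
    exact h _ (contDiff_foldr_pd hv l) R (lapl_foldr_pd_eq_zero hv hR l) x δ _ hδ (by linarith)
      (fun y hy => ih y (by linarith)) i

theorem iteratedDeriv_comp_smul_eq {u : EuclideanSpace ℝ (Fin n) → ℝ} (hu : ContDiff ℝ ∞ u)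
    (x : EuclideanSpace ℝ (Fin n)) (m : ℕ) :
    iteratedDeriv m (fun t : ℝ => u (t • x)) = fun t => (dirDeriv x)^[m] u (t • x) := by
  induction m generalizing u with
  | zero => simp
  | succ m ih =>
    rw [iteratedDeriv_succ', Function.iterate_succ_apply, ← ih (contDiff_dirDeriv hu x)]
    congr 1
    funext t
    have h1 : HasDerivAt (fun s : ℝ => s • x) x t := by simpa using (hasDerivAt_id t).smul_const x
    exact ((hu.differentiable (by simp) _).hasFDerivAt.comp_hasDerivAt t h1).deriv

theorem exists_abs_le_taylor (n T : ℕ) : ∃ C₁ C₂ : ℝ, 0 < C₁ ∧ 0 < C₂ ∧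
    ∀ u : EuclideanSpace ℝ (Fin n) → ℝ, ContDiff ℝ ∞ u →
      (∀ x ∈ ball (0 : EuclideanSpace ℝ (Fin n)) 1, lapl u x = 0) →
      ∀ A S : ℝ, (∀ y, ‖y‖ ≤ 1 / 4 → |u y| ≤ A) →
        (∀ l : List (Fin n), l.length ≤ T → |l.foldr pd u 0| ≤ S) →
        ∀ x, ‖x‖ ≤ 1 / 8 → |u x| ≤ C₁ * S + C₂ * ‖x‖ ^ (T + 1) * A := by
  obtain ⟨K, hK, h⟩ := exists_abs_foldr_pd_le n
  set δ : ℝ := 1 / (8 * (T + 1)) with hδdef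
  have hδ : 0 < δ := by positivity
  refine ⟨1 + ∑ m ∈ Finset.range (T + 1), (n : ℝ) ^ m, 1 + (n : ℝ) ^ (T + 1) * (K / δ) ^ (T + 1),
    by positivity, by positivity, fun u hu hu0 A S hA hS x hx => ?_⟩
  have hA0 : 0 ≤ A := (abs_nonneg _).trans (hA 0 (by simp))
  have hS0 : 0 ≤ S := (abs_nonneg _).trans (hS [] (by simp))
  have hg : ContDiff ℝ ∞ fun t : ℝ => u (t • x) := hu.comp (contDiff_id.smul contDiff_const)
  have hW : ∀ m : ℕ, ∀ t ∈ Set.Icc (0 : ℝ) 1,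
      iteratedDerivWithin m (fun t : ℝ => u (t • x)) (Set.Icc 0 1) t =
        (dirDeriv x)^[m] u (t • x) := by
    intro m t ht
    rw [iteratedDerivWithin_eq_iteratedDeriv (uniqueDiffOn_Icc one_pos)
      (hg.contDiffAt.of_le (by exact_mod_cast le_top)) ht, iteratedDeriv_comp_smul_eq hu]
  have hrem : ∀ t ∈ Set.Icc (0 : ℝ) 1,
      ‖iteratedDerivWithin (T + 1) (fun t : ℝ => u (t • x)) (Set.Icc 0 1) t‖ ≤
        (n * ‖x‖) ^ (T + 1) * ((K / δ) ^ (T + 1) * A) := by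
    intro t ht
    rw [hW _ t ht, Real.norm_eq_abs]
    refine abs_iterate_dirDeriv_le x _ _ hu fun l hl => ?_
    rw [← hl]
    refine h u hu 1 hu0 δ A (1 / 4) hδ (by norm_num) hA l _ ?_
    rw [hl, norm_smul, Real.norm_of_nonneg ht.1]
    have h1 : t * ‖x‖ ≤ 1 / 8 := (mul_le_of_le_one_left (norm_nonneg _) ht.2).trans hx
    have h2 : ((T + 1 : ℕ) : ℝ) * δ = 1 / 8 := by
      rw [hδdef]; push_cast; field_simp
    linarith
  have key := taylor_mean_remainder_bound (zero_le_one) (f := fun t : ℝ => u (t • x)) (n := T)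
    (hg.of_le (by exact_mod_cast le_top)).contDiffOn (Set.right_mem_Icc.2 zero_le_one) hrem
  have hT : |taylorWithinEval (fun t : ℝ => u (t • x)) T (Set.Icc 0 1) 0 1| ≤
      (∑ m ∈ Finset.range (T + 1), (n : ℝ) ^ m) * S := by
    rw [taylor_within_apply, Finset.sum_mul]
    refine (Finset.abs_sum_le_sum_abs _ _).trans (Finset.sum_le_sum fun m hm => ?_)
    rw [hW m 0 (Set.left_mem_Icc.2 zero_le_one), smul_eq_mul, abs_mul, zero_smul]
    have h1 := abs_iterate_dirDeriv_le x (0 : EuclideanSpace ℝ (Fin n)) m hu (B := S)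
      fun l hl => hS l (by rw [hl]; exact Nat.lt_succ_iff.1 (Finset.mem_range.1 hm))
    have h2 : |((m.factorial : ℝ))⁻¹ * (1 - 0) ^ m| ≤ 1 := by
      simp only [sub_zero, one_pow, mul_one, abs_inv, Nat.abs_cast]
      exact inv_le_one_of_one_le₀ (by exact_mod_cast m.factorial_pos)
    have h3 : (n * ‖x‖) ^ m ≤ (n : ℝ) ^ m := by
      gcongr
      exact mul_le_of_le_one_right (Nat.cast_nonneg _) (by linarith)
    calc _ ≤ 1 * ((n * ‖x‖) ^ m * S) := mul_le_mul h2 h1 (abs_nonneg _) zero_le_one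
      _ ≤ _ := by rw [one_mul]; gcongr
  have key2 : |u x - taylorWithinEval (fun t : ℝ => u (t • x)) T (Set.Icc 0 1) 0 1| ≤
      (n * ‖x‖) ^ (T + 1) * ((K / δ) ^ (T + 1) * A) := by
    have : (n * ‖x‖) ^ (T + 1) * ((K / δ) ^ (T + 1) * A) * (1 - 0) ^ (T + 1) / (T.factorial : ℝ) ≤
        (n * ‖x‖) ^ (T + 1) * ((K / δ) ^ (T + 1) * A) := by
      rw [sub_zero, one_pow, mul_one]
      exact div_le_self (by positivity) (by exact_mod_cast T.factorial_pos)
    refine le_trans ?_ this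
    simpa using key
  have key3 := abs_sub_abs_le_abs_sub (u x)
    (taylorWithinEval (fun t : ℝ => u (t • x)) T (Set.Icc 0 1) 0 1)
  have h4 : (n * ‖x‖) ^ (T + 1) * ((K / δ) ^ (T + 1) * A) =
      (n : ℝ) ^ (T + 1) * (K / δ) ^ (T + 1) * ‖x‖ ^ (T + 1) * A := by rw [mul_pow]; ring
  have h5 : 0 ≤ ‖x‖ ^ (T + 1) * A := by positivity
  nlinarith

theorem exists_bumpQ_le (n : ℕ) : ∃ C : ℝ, 0 < C ∧
    ∀ y z : EuclideanSpace ℝ (Fin n), ‖z‖ ≤ 1 / 2 → bumpQ n y ≤ C * bumpQ n z := by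
  obtain ⟨z₀, hz₀, hmin⟩ := (isCompact_closedBall (0 : EuclideanSpace ℝ (Fin n)) (1 / 2)).exists_isMinOn
    ⟨0, by simp⟩ contDiff_bumpQ.continuous.continuousOn
  obtain ⟨y₀, hmax⟩ := contDiff_bumpQ.continuous.exists_forall_ge_of_hasCompactSupport
    (hasCompactSupport_bumpQ (n := n))
  have hpos : 0 < bumpQ n z₀ := by
    refine cutQ_pos ?_
    have : ‖z₀‖ ≤ 1 / 2 := by simpa using hz₀
    nlinarith [norm_nonneg z₀]
  refine ⟨(bumpQ n y₀ + 1) / bumpQ n z₀, div_pos (by linarith [bumpQ_nonneg y₀]) hpos,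
    fun y z hz => ?_⟩
  have h1 : bumpQ n z₀ ≤ bumpQ n z := hmin (by simpa using hz)
  have h2 : bumpQ n y ≤ bumpQ n y₀ := hmax y
  rw [div_mul_eq_mul_div, le_div_iff₀ hpos]
  have := bumpQ_nonneg y₀
  exact mul_le_mul (by linarith) h1 hpos.le (by linarith)

theorem exists_sq_le_integral_bumpQ (n : ℕ) : ∃ C : ℝ, 0 < C ∧
    ∀ u : EuclideanSpace ℝ (Fin n) → ℝ, ContDiff ℝ ∞ u →
      (∀ x ∈ ball (0 : EuclideanSpace ℝ (Fin n)) 1, lapl u x = 0) →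
      ∀ x, ‖x‖ ≤ 1 / 4 → u x ^ 2 ≤ C * ∫ y, bumpQ n y * u y ^ 2 := by
  obtain ⟨C, hC, hCle⟩ := exists_bumpQ_le n
  set Q := ∫ y, bumpQ n y with hQ
  have hQ0 : 0 < Q := integral_bumpQ_pos
  refine ⟨C * 4 ^ n / Q, by positivity, fun u hu hu0 x hx => ?_⟩
  have hint : ∀ {g : EuclideanSpace ℝ (Fin n) → ℝ}, Continuous g →
      Integrable fun y => bumpQ n y * g y := fun hg =>
    (contDiff_bumpQ.continuous.mul hg).integrable_of_hasCompactSupport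
      hasCompactSupport_bumpQ.mul_right
  set U : EuclideanSpace ℝ (Fin n) → ℝ := fun y => u (x + (1 / 4 : ℝ) • y) with hU
  have hUc : Continuous U := (contDiff_comp_add_smul hu x _).continuous
  have hI2 : Integrable fun y => bumpQ n y * U y ^ 2 := hint (hUc.pow 2)
  have hmv : ∫ y, bumpQ n y * U y = Q * u x :=
    mean_value_bumpQ hu hu0 (by norm_num) (by linarith)
  have h1 : Q * u x ^ 2 ≤ ∫ y, bumpQ n y * U y ^ 2 := by
    have h0 : 0 ≤ ∫ y, bumpQ n y * (U y - u x) ^ 2 :=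
      integral_nonneg fun y => mul_nonneg (bumpQ_nonneg y) (sq_nonneg _)
    have hsub : Integrable fun y => bumpQ n y * U y ^ 2 - 2 * u x * (bumpQ n y * U y) :=
      hI2.sub ((hint hUc).const_mul _)
    have h : ∫ y, bumpQ n y * (U y - u x) ^ 2 =
        (∫ y, bumpQ n y * U y ^ 2) - 2 * u x * (∫ y, bumpQ n y * U y) + u x ^ 2 * Q := by
      rw [hQ, ← integral_const_mul, ← integral_const_mul, ← integral_sub hI2
        ((hint hUc).const_mul _), ← integral_add hsub]
      · congr 1; ext y; ring
      · exact (contDiff_bumpQ.continuous.integrable_of_hasCompactSupport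
          hasCompactSupport_bumpQ).const_mul _
    rw [h, hmv] at h0
    nlinarith
  set g : EuclideanSpace ℝ (Fin n) → ℝ := fun y => bumpQ n y * u y ^ 2 with hg
  have hgi : Integrable g := hint (hu.continuous.pow 2)
  have h2 : ∫ y, bumpQ n y * U y ^ 2 ≤ ∫ y, C * g (x + (1 / 4 : ℝ) • y) := by
    refine integral_mono hI2 ?_ fun y => ?_
    · exact ((hgi.comp_add_left x).comp_smul (by norm_num : (1 / 4 : ℝ) ≠ 0)).const_mul C
    · change bumpQ n y * U y ^ 2 ≤ C * (bumpQ n (x + (1 / 4 : ℝ) • y) * U y ^ 2)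
      rw [← mul_assoc]
      refine mul_le_mul_of_nonneg_right ?_ (sq_nonneg _)
      by_cases hy : 1 ≤ ‖y‖
      · rw [bumpQ_eq_zero hy]
        exact mul_nonneg hC.le (bumpQ_nonneg _)
      · refine hCle _ _ ((norm_add_le _ _).trans ?_)
        rw [norm_smul, Real.norm_of_nonneg (by norm_num)]
        linarith [not_le.1 hy]
  have h3 : ∫ y, C * g (x + (1 / 4 : ℝ) • y) = C * 4 ^ n * ∫ y, g y := by
    rw [integral_const_mul, Measure.integral_comp_smul volume (fun z => g (x + z)) (1 / 4 : ℝ),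
      integral_add_left_eq_self g x]
    simp [abs_of_nonneg, mul_assoc]
  rw [h3] at h2
  rw [div_mul_eq_mul_div, le_div_iff₀ hQ0]
  linarith

end Estimates

section Frequency

variable {n : ℕ}

theorem nonpos_of_eq_zero_on_sphere (hn : 0 < n) {u : EuclideanSpace ℝ (Fin n) → ℝ}
    (hu : ContDiff ℝ ∞ u) {s : ℝ} (hs : 0 < s)
    (hu0 : ∀ x ∈ ball (0 : EuclideanSpace ℝ (Fin n)) s, lapl u x = 0)
    (hz : ∀ x ∈ sphere (0 : EuclideanSpace ℝ (Fin n)) s, u x = 0) :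
    ∀ x ∈ closedBall (0 : EuclideanSpace ℝ (Fin n)) s, u x ≤ 0 := by
  obtain ⟨x₀, hx₀, hmax⟩ := (isCompact_closedBall (0 : EuclideanSpace ℝ (Fin n)) s).exists_isMaxOn
    ⟨0, by simpa using hs.le⟩ hu.continuous.continuousOn
  rw [mem_closedBall_zero_iff] at hx₀
  obtain ⟨e, he, hxe⟩ : ∃ e : EuclideanSpace ℝ (Fin n), ‖e‖ = 1 ∧ x₀ = ‖x₀‖ • e := by
    by_cases h0 : x₀ = 0
    · exact ⟨EuclideanSpace.single ⟨0, hn⟩ 1, by simp, by simp [h0]⟩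
    · refine ⟨‖x₀‖⁻¹ • x₀, norm_smul_inv_norm h0, ?_⟩
      rw [smul_inv_smul₀ (norm_ne_zero_iff.2 h0)]
  set δ := s - ‖x₀‖ with hδ
  have hδ0 : 0 ≤ δ := sub_nonneg.2 hx₀
  have hmem : ∀ y : EuclideanSpace ℝ (Fin n), ‖y‖ ≤ 1 →
      x₀ + δ • y ∈ closedBall (0 : EuclideanSpace ℝ (Fin n)) s := by
    intro y hy
    rw [mem_closedBall_zero_iff]
    refine (norm_add_le _ _).trans ?_
    rw [norm_smul, Real.norm_of_nonneg hδ0]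
    nlinarith
  have hcont : Continuous fun y => u (x₀ + δ • y) := (contDiff_comp_add_smul hu x₀ δ).continuous
  have hball : ∀ y ∈ ball (0 : EuclideanSpace ℝ (Fin n)) 1, u (x₀ + δ • y) = u x₀ := by
    intro y hy
    rw [mem_ball_zero_iff] at hy
    by_contra hne
    have hpos := Continuous.integral_pos_of_hasCompactSupport_nonneg_nonzero
      (μ := (volume : Measure (EuclideanSpace ℝ (Fin n))))
      (f := fun y => bumpQ n y * (u x₀ - u (x₀ + δ • y)))
      (contDiff_bumpQ.continuous.mul (continuous_const.sub hcont))
      hasCompactSupport_bumpQ.mul_right (x := y) (fun z => by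
        by_cases hz1 : 1 ≤ ‖z‖
        · simp [bumpQ_eq_zero hz1]
        · exact mul_nonneg (bumpQ_nonneg z) (sub_nonneg.2 (hmax (hmem z (not_le.1 hz1).le)))) ?_
    · have h1 : ∫ y, bumpQ n y * (u x₀ - u (x₀ + δ • y)) =
          (∫ y, bumpQ n y) * u x₀ - ∫ y, bumpQ n y * u (x₀ + δ • y) := by
        rw [← integral_mul_const, ← integral_sub]
        · congr 1; ext y; ring
        · exact (contDiff_bumpQ.continuous.integrable_of_hasCompactSupport
            hasCompactSupport_bumpQ).mul_const _
        · exact (contDiff_bumpQ.continuous.mul hcont).integrable_of_hasCompactSupport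
            hasCompactSupport_bumpQ.mul_right
      rw [h1, mean_value_bumpQ hu hu0 hδ0 (by simp [hδ]), sub_self] at hpos
      exact lt_irrefl _ hpos
    · refine mul_ne_zero (cutQ_pos ?_).ne' (sub_ne_zero.2 (Ne.symm hne))
      exact pow_lt_one₀ (norm_nonneg _) hy two_ne_zero
  have hcl : closedBall (0 : EuclideanSpace ℝ (Fin n)) 1 ⊆ {y | u (x₀ + δ • y) = u x₀} := by
    rw [← closure_ball (0 : EuclideanSpace ℝ (Fin n)) one_ne_zero]
    exact closure_minimal hball (isClosed_eq hcont continuous_const)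
  have h1 : u (x₀ + δ • e) = u x₀ := hcl (by simp [he])
  have h2 : u (x₀ + δ • e) = 0 := by
    refine hz _ ?_
    rw [mem_sphere_zero_iff_norm]
    nth_rewrite 1 [hxe]
    rw [← add_smul, norm_smul, he, mul_one, hδ, add_sub_cancel, Real.norm_of_nonneg hs.le]
  intro x hx
  have : u x ≤ u x₀ := hmax hx
  linarith

theorem eq_zero_of_eq_zero_on_sphere (hn : 0 < n) {u : EuclideanSpace ℝ (Fin n) → ℝ}
    (hu : ContDiff ℝ ∞ u) {s : ℝ} (hs : 0 < s)
    (hu0 : ∀ x ∈ ball (0 : EuclideanSpace ℝ (Fin n)) s, lapl u x = 0)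
    (hz : ∀ x ∈ sphere (0 : EuclideanSpace ℝ (Fin n)) s, u x = 0) :
    ∀ x ∈ closedBall (0 : EuclideanSpace ℝ (Fin n)) s, u x = 0 := by
  have hneg : ∀ (v : EuclideanSpace ℝ (Fin n) → ℝ) i, pd i (fun y => -v y) = fun y => -pd i v y := by
    intro v i
    funext y
    simp [pd, fderiv_fun_neg]
  intro x hx
  refine le_antisymm (nonpos_of_eq_zero_on_sphere hn hu hs hu0 hz x hx) ?_
  have := nonpos_of_eq_zero_on_sphere hn hu.neg hs (fun y hy => ?_) (fun y hy => by simp [hz y hy]) x hx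
  · simpa using this
  · have h := hu0 y hy
    change lapl (fun y => -u y) y = 0
    simp only [lapl, hneg, Finset.sum_neg_distrib] at h ⊢
    rw [h, neg_zero]

/-- The squared length of the gradient of `u`. -/
def gradSq (u : EuclideanSpace ℝ (Fin n) → ℝ) (x : EuclideanSpace ℝ (Fin n)) : ℝ :=
  ∑ i, pd i u x ^ 2

theorem gradSq_nonneg (u : EuclideanSpace ℝ (Fin n) → ℝ) (x : EuclideanSpace ℝ (Fin n)) :
    0 ≤ gradSq u x := Finset.sum_nonneg fun _ _ => sq_nonneg _

theorem continuous_gradSq {u : EuclideanSpace ℝ (Fin n) → ℝ} (hu : ContDiff ℝ ∞ u) :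
    Continuous (gradSq u) :=
  continuous_finsetSum _ fun i _ => (contDiff_pd hu i).continuous.pow 2

theorem gradSq_eq_zero_on_closedBall {u : EuclideanSpace ℝ (Fin n) → ℝ}
    (hu : ContDiff ℝ ∞ u) {s : ℝ} (hs : 0 < s)
    (hz : ∀ x ∈ closedBall (0 : EuclideanSpace ℝ (Fin n)) s, u x = 0) :
    ∀ x ∈ closedBall (0 : EuclideanSpace ℝ (Fin n)) s, gradSq u x = 0 := by
  have h : closedBall (0 : EuclideanSpace ℝ (Fin n)) s ⊆ {x | gradSq u x = 0} := by
    rw [← closure_ball (0 : EuclideanSpace ℝ (Fin n)) hs.ne']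
    refine closure_minimal (fun x hx => ?_) (isClosed_eq (continuous_gradSq hu) continuous_const)
    have : u =ᶠ[nhds x] fun _ => 0 := by
      filter_upwards [isOpen_ball.mem_nhds hx] with y hy using hz y (ball_subset_closedBall hy)
    simp [gradSq, pd, this.fderiv_eq]
  exact h

theorem integrableOn_sphere_sq (hn : 0 < n) {u : EuclideanSpace ℝ (Fin n) → ℝ} (hu : Continuous u)
    {s : ℝ} (hs : 0 < s) :
    IntegrableOn (fun x => u x ^ 2) (sphere (0 : EuclideanSpace ℝ (Fin n)) s) μH[(n : ℝ) - 1] := by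
  obtain ⟨C, hC⟩ := sphere_lintegral_hausdorffMeasure_le hn
  have hc : Continuous fun x => u x ^ 2 := hu.pow 2
  refine ⟨hc.aestronglyMeasurable, ?_⟩
  have h := hC s hs (fun x => ‖u x ^ 2‖ₑ) hc.measurable.enorm
  refine h.trans_lt (ENNReal.mul_lt_top (ENNReal.mul_lt_top ENNReal.coe_lt_top
    ENNReal.ofReal_lt_top) ?_)
  have hc' : Continuous fun y : sphere (0 : EuclideanSpace ℝ (Fin n)) 1 =>
      u (s • (y : EuclideanSpace ℝ (Fin n))) ^ 2 :=
    hc.comp (continuous_subtype_val.const_smul s)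
  have : Integrable (fun y : sphere (0 : EuclideanSpace ℝ (Fin n)) 1 =>
      u (s • (y : EuclideanSpace ℝ (Fin n))) ^ 2) volume.toSphere :=
    hc'.integrable_of_hasCompactSupport (HasCompactSupport.of_compactSpace _)
  exact this.2

theorem mul_setIntegral_gradSq_le (hn : 0 < n) {u : EuclideanSpace ℝ (Fin n) → ℝ}
    (hu : ContDiff ℝ ∞ u) {s N : ℝ} (hs : 0 < s)
    (hu0 : ∀ x ∈ ball (0 : EuclideanSpace ℝ (Fin n)) s, lapl u x = 0) (hf : hfreq u s ≤ N) :
    s * ∫ x in closedBall (0 : EuclideanSpace ℝ (Fin n)) s, gradSq u x ≤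
      N * ∫ x in sphere (0 : EuclideanSpace ℝ (Fin n)) s, u x ^ 2 ∂ μH[(n : ℝ) - 1] := by
  rcases (integral_nonneg fun x => sq_nonneg (u x) : 0 ≤
    ∫ x in sphere (0 : EuclideanSpace ℝ (Fin n)) s, u x ^ 2 ∂ μH[(n : ℝ) - 1]).lt_or_eq with h | h
  · exact (div_le_iff₀ h).1 hf
  · have hz : ∀ x ∈ sphere (0 : EuclideanSpace ℝ (Fin n)) s, u x = 0 := by
      have hae := (setIntegral_eq_zero_iff_of_nonneg_ae (Filter.Eventually.of_forall fun x =>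
        sq_nonneg (u x)) (integrableOn_sphere_sq hn hu.continuous hs)).1 h.symm
      intro x hx
      by_contra hne
      have hpos := hausdorffMeasure_sphere_inter_pos hs hx
        (isOpen_ne_fun hu.continuous continuous_const) hne
      have hnull := (ae_restrict_iff' (isClosed_sphere.measurableSet)).1 hae
      refine hpos.ne' (measure_mono_null ?_ hnull)
      rintro y ⟨hy1, hy2⟩ hy3
      exact hy2 (by simpa using hy3 hy1)
    rw [← h, setIntegral_congr_fun isClosed_closedBall.measurableSet
      (gradSq_eq_zero_on_closedBall hu hs (eq_zero_of_eq_zero_on_sphere hn hu hs hu0 hz))]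
    simp

theorem exists_mul_setLIntegral_gradSq_le (hn : 0 < n) {N : ℝ} (hN : 0 ≤ N) :
    ∃ C : ℝ≥0, ∀ u : EuclideanSpace ℝ (Fin n) → ℝ, ContDiff ℝ ∞ u → ∀ s : ℝ, 0 < s →
      (∀ x ∈ ball (0 : EuclideanSpace ℝ (Fin n)) s, lapl u x = 0) → hfreq u s ≤ N →
      ENNReal.ofReal s *
          ∫⁻ x in closedBall (0 : EuclideanSpace ℝ (Fin n)) s, ENNReal.ofReal (gradSq u x) ≤
        C * (ENNReal.ofReal (s ^ (n - 1)) *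
          ∫⁻ y : sphere (0 : EuclideanSpace ℝ (Fin n)) 1,
            ENNReal.ofReal (u (s • (y : EuclideanSpace ℝ (Fin n))) ^ 2)
              ∂(volume : Measure (EuclideanSpace ℝ (Fin n))).toSphere) := by
  obtain ⟨C, hC⟩ := sphere_lintegral_hausdorffMeasure_le hn
  refine ⟨N.toNNReal * C, fun u hu s hs hu0 hf => ?_⟩
  have h := mul_setIntegral_gradSq_le hn hu hs hu0 hf
  have h1 : ENNReal.ofReal (∫ x in closedBall (0 : EuclideanSpace ℝ (Fin n)) s, gradSq u x) =
      ∫⁻ x in closedBall (0 : EuclideanSpace ℝ (Fin n)) s, ENNReal.ofReal (gradSq u x) :=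
    ofReal_integral_eq_lintegral_ofReal
      ((continuous_gradSq hu).continuousOn.integrableOn_compact (isCompact_closedBall _ _))
      (Filter.Eventually.of_forall fun x => gradSq_nonneg u x)
  have h2 : ENNReal.ofReal
      (∫ x in sphere (0 : EuclideanSpace ℝ (Fin n)) s, u x ^ 2 ∂ μH[(n : ℝ) - 1]) =
      ∫⁻ x in sphere (0 : EuclideanSpace ℝ (Fin n)) s, ENNReal.ofReal (u x ^ 2) ∂ μH[(n : ℝ) - 1] :=
    ofReal_integral_eq_lintegral_ofReal (integrableOn_sphere_sq hn hu.continuous hs)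
      (Filter.Eventually.of_forall fun x => sq_nonneg _)
  rw [← h1, ← ENNReal.ofReal_mul hs.le]
  refine (ENNReal.ofReal_le_ofReal h).trans ?_
  rw [ENNReal.ofReal_mul hN, h2, ENNReal.coe_mul, mul_assoc (N.toNNReal : ℝ≥0∞)]
  refine mul_le_mul_right (α := ℝ≥0∞) ?_ _
  rw [← mul_assoc]
  exact hC s hs (fun x => ENNReal.ofReal (u x ^ 2)) (hu.continuous.pow 2).measurable.ennreal_ofReal

end Frequency

section Doubling

variable {n : ℕ}

theorem ofReal_bumpF_le_lintegral (y : EuclideanSpace ℝ (Fin n)) {r : ℝ} (hr : 0 < r) :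
    ENNReal.ofReal (r ^ 2 * bumpF n (r⁻¹ • y)) ≤
      ∫⁻ s in Set.Ioi (0 : ℝ), Set.indicator (Set.Ici ‖y‖)
        (fun s => ENNReal.ofReal (2 * s * cutQ ((r⁻¹ * s) ^ 2))) s := by
  have hnorm : ‖r⁻¹ • y‖ = r⁻¹ * ‖y‖ := by rw [norm_smul, norm_inv, Real.norm_of_nonneg hr.le]
  by_cases hy : r ≤ ‖y‖
  · rw [bumpF_eq_zero (by rw [hnorm, ← div_eq_inv_mul]; exact (one_le_div hr).2 hy)]
    simp
  · push Not at hy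
    have hcont : Continuous fun s : ℝ => 2 * s * cutQ ((r⁻¹ * s) ^ 2) := by
      have := contDiff_cutQ.continuous
      fun_prop
    have hderiv : ∀ s : ℝ, HasDerivAt (fun s => -(r ^ 2 * cutF ((r⁻¹ * s) ^ 2)))
        (2 * s * cutQ ((r⁻¹ * s) ^ 2)) s := by
      intro s
      have h1 : HasDerivAt (fun s : ℝ => (r⁻¹ * s) ^ 2) (2 * (r⁻¹ * s) * r⁻¹) s := by
        simpa using (((hasDerivAt_id s).const_mul r⁻¹).fun_pow 2)
      have h2 := (((hasDerivAt_cutF _).comp s h1).const_mul (r ^ 2)).neg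
      refine h2.congr_deriv ?_
      field_simp
    have hFTC : ∫ s in ‖y‖..r, 2 * s * cutQ ((r⁻¹ * s) ^ 2) = r ^ 2 * bumpF n (r⁻¹ • y) := by
      rw [intervalIntegral.integral_eq_sub_of_hasDerivAt (fun s _ => hderiv s)
        (hcont.intervalIntegrable _ _), bumpF, hnorm, inv_mul_cancel₀ hr.ne',
        cutF_eq_zero (by norm_num : (1 : ℝ) ≤ 1 ^ 2)]
      ring
    rw [← hFTC, intervalIntegral.integral_of_le hy.le, ofReal_integral_eq_lintegral_ofReal
      ((hcont.intervalIntegrable _ _).1) ?_, ← lintegral_indicator measurableSet_Ioc,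
      ← lintegral_indicator measurableSet_Ioi]
    · refine lintegral_mono fun s => ?_
      by_cases hs : s ∈ Set.Ioc ‖y‖ r
      · rw [Set.indicator_of_mem hs, Set.indicator_of_mem
          (show s ∈ Set.Ioi (0 : ℝ) from (norm_nonneg y).trans_lt hs.1),
          Set.indicator_of_mem (show s ∈ Set.Ici ‖y‖ from hs.1.le)]
      · rw [Set.indicator_of_notMem hs]
        exact zero_le
    · filter_upwards [ae_restrict_mem measurableSet_Ioc] with s hs
      exact mul_nonneg (mul_nonneg zero_le_two ((norm_nonneg y).trans hs.1.le)) (cutQ_nonneg _)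

theorem exists_lintegral_bumpF_gradSq_le (hn : 0 < n) {N : ℝ} (hN : 0 ≤ N) :
    ∃ C : ℝ≥0, ∀ u : EuclideanSpace ℝ (Fin n) → ℝ, ContDiff ℝ ∞ u → ∀ r : ℝ, 0 < r →
      (∀ x ∈ ball (0 : EuclideanSpace ℝ (Fin n)) r, lapl u x = 0) →
      (∀ s, 0 < s → s < r → hfreq u s ≤ N) →
      ∫⁻ y, ENNReal.ofReal (r ^ 2 * bumpF n (r⁻¹ • y)) * ENNReal.ofReal (gradSq u y) ≤
        C * ∫⁻ y, ENNReal.ofReal (bumpQ n (r⁻¹ • y) * u y ^ 2) := by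
  obtain ⟨C, hC⟩ := exists_mul_setLIntegral_gradSq_le hn hN
  refine ⟨2 * C, fun u hu r hr hu0 hf => ?_⟩
  have hQc := contDiff_cutQ.continuous
  have hGm : Measurable fun y => ENNReal.ofReal (gradSq u y) :=
    (continuous_gradSq hu).measurable.ennreal_ofReal
  set c : ℝ → ℝ≥0∞ := fun s => ENNReal.ofReal (2 * s * cutQ ((r⁻¹ * s) ^ 2)) with hc
  have hcm : Measurable c := by
    have : Continuous fun s : ℝ => 2 * s * cutQ ((r⁻¹ * s) ^ 2) := by fun_prop
    exact this.measurable.ennreal_ofReal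
  have hgm : Measurable fun y => ENNReal.ofReal (bumpQ n (r⁻¹ • y) * u y ^ 2) := by
    have : Continuous fun y => bumpQ n (r⁻¹ • y) * u y ^ 2 :=
      ((contDiff_bumpQ.continuous).comp (continuous_const_smul _)).mul (hu.continuous.pow 2)
    exact this.measurable.ennreal_ofReal
  calc ∫⁻ y, ENNReal.ofReal (r ^ 2 * bumpF n (r⁻¹ • y)) * ENNReal.ofReal (gradSq u y)
      ≤ ∫⁻ y, (∫⁻ s in Set.Ioi (0 : ℝ), Set.indicator (Set.Ici ‖y‖) c s) *
          ENNReal.ofReal (gradSq u y) := by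
        gcongr with y
        exact ofReal_bumpF_le_lintegral y hr
    _ = ∫⁻ y, ∫⁻ s in Set.Ioi (0 : ℝ),
          Set.indicator (Set.Ici ‖y‖) c s * ENNReal.ofReal (gradSq u y) := by
        congr 1; ext y
        rw [lintegral_mul_const _ (hcm.indicator measurableSet_Ici)]
    _ = ∫⁻ s in Set.Ioi (0 : ℝ), ∫⁻ y,
          Set.indicator (Set.Ici ‖y‖) c s * ENNReal.ofReal (gradSq u y) := by
        refine lintegral_lintegral_swap ?_
        have hset : MeasurableSet {p : EuclideanSpace ℝ (Fin n) × ℝ | ‖p.1‖ ≤ p.2} :=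
          measurableSet_le measurable_fst.norm measurable_snd
        have hm : Measurable fun p : EuclideanSpace ℝ (Fin n) × ℝ =>
            Set.indicator {p : EuclideanSpace ℝ (Fin n) × ℝ | ‖p.1‖ ≤ p.2} (fun p => c p.2) p *
              ENNReal.ofReal (gradSq u p.1) :=
          ((hcm.comp measurable_snd).indicator hset).mul (hGm.comp measurable_fst)
        exact hm.aemeasurable
    _ ≤ ∫⁻ s in Set.Ioi (0 : ℝ), (2 * C) * (ENNReal.ofReal (s ^ (n - 1)) *
          ∫⁻ z : sphere (0 : EuclideanSpace ℝ (Fin n)) 1,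
            ENNReal.ofReal (bumpQ n (r⁻¹ • (s • (z : EuclideanSpace ℝ (Fin n)))) *
              u (s • (z : EuclideanSpace ℝ (Fin n))) ^ 2)
              ∂(volume : Measure (EuclideanSpace ℝ (Fin n))).toSphere) := by
        refine setLIntegral_mono' measurableSet_Ioi fun s hs => ?_
        have hs : 0 < s := hs
        have h1 : ∫⁻ y, Set.indicator (Set.Ici ‖y‖) c s * ENNReal.ofReal (gradSq u y) =
            c s * ∫⁻ y in closedBall (0 : EuclideanSpace ℝ (Fin n)) s,
              ENNReal.ofReal (gradSq u y) := by
          rw [← lintegral_indicator isClosed_closedBall.measurableSet, ← lintegral_const_mul _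
            (hGm.indicator isClosed_closedBall.measurableSet)]
          congr 1; ext y
          by_cases hy : ‖y‖ ≤ s
          · rw [Set.indicator_of_mem (show s ∈ Set.Ici ‖y‖ from hy),
              Set.indicator_of_mem (mem_closedBall_zero_iff.2 hy)]
          · rw [Set.indicator_of_notMem (show s ∉ Set.Ici ‖y‖ from hy),
              Set.indicator_of_notMem (mt mem_closedBall_zero_iff.1 hy), zero_mul, mul_zero]
        rw [h1]
        by_cases hsr : s < r
        · have h2 : ∀ z : sphere (0 : EuclideanSpace ℝ (Fin n)) 1,
              bumpQ n (r⁻¹ • (s • (z : EuclideanSpace ℝ (Fin n)))) = cutQ ((r⁻¹ * s) ^ 2) := by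
            intro z
            rw [bumpQ, smul_smul, norm_smul, norm_eq_of_mem_sphere, mul_one,
              Real.norm_of_nonneg (mul_nonneg (inv_nonneg.2 hr.le) hs.le)]
          have h3 : ∫⁻ z : sphere (0 : EuclideanSpace ℝ (Fin n)) 1,
              ENNReal.ofReal (bumpQ n (r⁻¹ • (s • (z : EuclideanSpace ℝ (Fin n)))) *
                u (s • (z : EuclideanSpace ℝ (Fin n))) ^ 2)
                ∂(volume : Measure (EuclideanSpace ℝ (Fin n))).toSphere =
              ENNReal.ofReal (cutQ ((r⁻¹ * s) ^ 2)) *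
                ∫⁻ z : sphere (0 : EuclideanSpace ℝ (Fin n)) 1,
                  ENNReal.ofReal (u (s • (z : EuclideanSpace ℝ (Fin n))) ^ 2)
                  ∂(volume : Measure (EuclideanSpace ℝ (Fin n))).toSphere := by
            rw [← lintegral_const_mul']
            · congr 1; ext z
              rw [h2, ENNReal.ofReal_mul (cutQ_nonneg _)]
            · exact ENNReal.ofReal_ne_top
          rw [h3]
          have h4 : c s = 2 * (ENNReal.ofReal (cutQ ((r⁻¹ * s) ^ 2)) * ENNReal.ofReal s) := by
            rw [← ENNReal.ofReal_mul (cutQ_nonneg _), ← ENNReal.ofReal_ofNat,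
              ← ENNReal.ofReal_mul zero_le_two]
            exact congrArg ENNReal.ofReal (by ring)
          have h5 := hC u hu s hs (fun x hx => hu0 x (ball_subset_ball hsr.le hx)) (hf s hs hsr)
          rw [h4]
          set q := ENNReal.ofReal (cutQ ((r⁻¹ * s) ^ 2))
          refine le_trans (le_of_eq ?_) ((mul_le_mul_right (α := ℝ≥0∞) h5 (2 * q)).trans
            (le_of_eq ?_)) <;> ring
        · have h6 : c s = 0 := by
            have : 1 ≤ (r⁻¹ * s) ^ 2 := by
              refine one_le_pow₀ ?_
              rw [← div_eq_inv_mul]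
              exact (one_le_div hr).2 (not_lt.1 hsr)
            simp [hc, cutQ_eq_zero this]
          rw [h6, zero_mul]
          exact zero_le
    _ = (2 * C) * ∫⁻ y, ENNReal.ofReal (bumpQ n (r⁻¹ • y) * u y ^ 2) := by
        rw [lintegral_const_mul', lintegral_eq_lintegral_polar hn _ hgm]
        exact ENNReal.mul_ne_top (by simp) ENNReal.coe_ne_top
    _ = _ := by simp

theorem exists_integral_bumpF_gradSq_le (hn : 0 < n) {N : ℝ} (hN : 0 ≤ N) :
    ∃ C : ℝ, 0 ≤ C ∧ ∀ u : EuclideanSpace ℝ (Fin n) → ℝ, ContDiff ℝ ∞ u → ∀ r : ℝ, 0 < r →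
      (∀ x ∈ ball (0 : EuclideanSpace ℝ (Fin n)) r, lapl u x = 0) →
      (∀ s, 0 < s → s < r → hfreq u s ≤ N) →
      r ^ 2 * ∫ y, bumpF n y * gradSq u (r • y) ≤ C * ∫ y, bumpQ n y * u (r • y) ^ 2 := by
  obtain ⟨C, hC⟩ := exists_lintegral_bumpF_gradSq_le hn hN
  refine ⟨C, C.2, fun u hu r hr hu0 hf => ?_⟩
  have h := hC u hu r hr hu0 hf
  have hFc : Continuous fun y => bumpF n (r⁻¹ • y) * gradSq u y :=
    ((contDiff_bumpF.continuous).comp (continuous_const_smul _)).mul (continuous_gradSq hu)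
  have hQc : Continuous fun y => bumpQ n (r⁻¹ • y) * u y ^ 2 :=
    ((contDiff_bumpQ.continuous).comp (continuous_const_smul _)).mul (hu.continuous.pow 2)
  have hFi : Integrable fun y => bumpF n (r⁻¹ • y) * gradSq u y :=
    hFc.integrable_of_hasCompactSupport
      (hasCompactSupport_bumpF.comp_smul (inv_ne_zero hr.ne')).mul_right
  have hQi : Integrable fun y => bumpQ n (r⁻¹ • y) * u y ^ 2 :=
    hQc.integrable_of_hasCompactSupport
      (hasCompactSupport_bumpQ.comp_smul (inv_ne_zero hr.ne')).mul_right
  have h1 : ∫⁻ y, ENNReal.ofReal (r ^ 2 * bumpF n (r⁻¹ • y)) * ENNReal.ofReal (gradSq u y) =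
      ENNReal.ofReal (r ^ 2 * ∫ y, bumpF n (r⁻¹ • y) * gradSq u y) := by
    rw [← integral_const_mul, ofReal_integral_eq_lintegral_ofReal (hFi.const_mul _)
      (Filter.Eventually.of_forall fun y => mul_nonneg (sq_nonneg r)
        (mul_nonneg (bumpF_nonneg _) (gradSq_nonneg u y)))]
    congr 1; ext y
    rw [← ENNReal.ofReal_mul (mul_nonneg (sq_nonneg r) (bumpF_nonneg _)), mul_assoc]
  have hQ0 : ∀ y, 0 ≤ bumpQ n (r⁻¹ • y) * u y ^ 2 := fun y =>
    mul_nonneg (bumpQ_nonneg _) (sq_nonneg _)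
  rw [h1, ← ofReal_integral_eq_lintegral_ofReal hQi (Filter.Eventually.of_forall hQ0),
    ← ENNReal.ofReal_coe_nnreal, ← ENNReal.ofReal_mul (NNReal.coe_nonneg C),
    ENNReal.ofReal_le_ofReal_iff (mul_nonneg (NNReal.coe_nonneg C) (integral_nonneg hQ0))] at h
  have hF' := Measure.integral_comp_smul (volume : Measure (EuclideanSpace ℝ (Fin n)))
    (fun y => bumpF n (r⁻¹ • y) * gradSq u y) r
  have hQ' := Measure.integral_comp_smul (volume : Measure (EuclideanSpace ℝ (Fin n)))
    (fun y => bumpQ n (r⁻¹ • y) * u y ^ 2) r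
  simp only [inv_smul_smul₀ hr.ne', smul_eq_mul] at hF' hQ'
  rw [hF', hQ', mul_left_comm, mul_left_comm (C : ℝ)]
  exact mul_le_mul_of_nonneg_left h (abs_nonneg _)

/-- The average of `u (r y) ^ 2` against the bump `bumpQ`. -/
def wavg (u : EuclideanSpace ℝ (Fin n) → ℝ) (r : ℝ) : ℝ := ∫ y, bumpQ n y * u (r • y) ^ 2

theorem wavg_nonneg (u : EuclideanSpace ℝ (Fin n) → ℝ) (r : ℝ) : 0 ≤ wavg u r :=
  integral_nonneg fun y => mul_nonneg (bumpQ_nonneg y) (sq_nonneg _)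

theorem hasDerivAt_wavg {u : EuclideanSpace ℝ (Fin n) → ℝ} (hu : ContDiff ℝ ∞ u) {r : ℝ}
    (hr : 0 < r) (hu0 : ∀ x ∈ ball (0 : EuclideanSpace ℝ (Fin n)) r, lapl u x = 0) :
    HasDerivAt (wavg u) (r * ∫ y, bumpF n y * gradSq u (r • y)) r := by
  have hu2 : ContDiff ℝ ∞ fun y => u y ^ 2 := hu.pow 2
  have h := hasDerivAt_integral_mul_comp contDiff_bumpQ.continuous hasCompactSupport_bumpQ hu2 0 r
  rw [integral_bumpQ_mul_fderiv hu2] at h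
  simp only [zero_add] at h
  have h1 : ∀ y, bumpF n y * lapl (fun y => u y ^ 2) (r • y) =
      2 * (bumpF n y * gradSq u (r • y)) := by
    intro y
    by_cases hy : 1 ≤ ‖y‖
    · simp [bumpF_eq_zero hy]
    · have hmem : r • y ∈ ball (0 : EuclideanSpace ℝ (Fin n)) r := by
        rw [mem_ball_zero_iff, norm_smul, Real.norm_of_nonneg hr.le]
        exact mul_lt_of_lt_one_right hr (not_le.1 hy)
      rw [lapl_sq hu, hu0 _ hmem, gradSq]
      ring
  simp_rw [h1, integral_const_mul] at h
  exact h.congr_deriv (by ring)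

theorem exists_wavg_mul_pow_le (hn : 0 < n) {N : ℝ} (hN : 0 ≤ N) :
    ∃ k : ℕ, ∀ u : EuclideanSpace ℝ (Fin n) → ℝ, ContDiff ℝ ∞ u →
      (∀ x ∈ ball (0 : EuclideanSpace ℝ (Fin n)) 1, lapl u x = 0) →
      (∀ s, 0 < s → s < 1 → hfreq u s ≤ N) →
      ∀ ρ, 0 < ρ → ρ ≤ 1 → wavg u 1 * ρ ^ k ≤ wavg u ρ := by
  obtain ⟨C, hC0, hC⟩ := exists_integral_bumpF_gradSq_le hn hN
  obtain ⟨k, hk⟩ := exists_nat_ge C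
  refine ⟨k, fun u hu hu0 hf ρ hρ hρ1 => ?_⟩
  have hd : ∀ r, 0 < r → r ≤ 1 → HasDerivAt (fun r => wavg u r / r ^ k) _ r := fun r hr hr1 =>
    (hasDerivAt_wavg hu hr fun x hx => hu0 x (ball_subset_ball hr1 hx)).fun_div
      (hasDerivAt_pow k r) (pow_ne_zero k hr.ne')
  have hanti : AntitoneOn (fun r => wavg u r / r ^ k) (Set.Icc ρ 1) := by
    refine antitoneOn_of_deriv_nonpos (convex_Icc _ _) (fun r hr =>
      (hd r (hρ.trans_le hr.1) hr.2).continuousAt.continuousWithinAt) (fun r hr => ?_)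
      fun r hr => ?_
    · rw [interior_Icc] at hr
      exact (hd r (hρ.trans hr.1) hr.2.le).differentiableAt.differentiableWithinAt
    · rw [interior_Icc] at hr
      have hr0 := hρ.trans hr.1
      rw [(hd r hr0 hr.2.le).deriv]
      refine div_nonpos_of_nonpos_of_nonneg ?_ (sq_nonneg _)
      have h1 := hC u hu r hr0 (fun x hx => hu0 x (ball_subset_ball hr.2.le hx))
        fun s hs hsr => hf s hs (hsr.trans hr.2)
      have h2 : r ^ 2 * ∫ y, bumpF n y * gradSq u (r • y) ≤ k * wavg u r :=
        h1.trans (mul_le_mul_of_nonneg_right hk (wavg_nonneg u r))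
      have h3 : r * ((k : ℝ) * r ^ (k - 1)) = k * r ^ k := by
        rcases k with _ | k
        · simp
        · rw [Nat.add_sub_cancel]; ring
      refine nonpos_of_mul_nonpos_right ?_ hr0
      calc _ = r ^ k * (r ^ 2 * ∫ y, bumpF n y * gradSq u (r • y)) -
            wavg u r * (r * ((k : ℝ) * r ^ (k - 1))) := by ring
        _ = r ^ k * (r ^ 2 * (∫ y, bumpF n y * gradSq u (r • y)) - k * wavg u r) := by
            rw [h3]; ring
        _ ≤ 0 := mul_nonpos_of_nonneg_of_nonpos (by positivity) (by linarith)
  have h := hanti (Set.left_mem_Icc.2 hρ1) (Set.right_mem_Icc.2 hρ1) hρ1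
  simp only [one_pow, div_one] at h
  exact (le_div_iff₀ (pow_pos hρ k)).1 h

end Doubling

section Main

variable {n : ℕ}

/-- The sum of the squares of all partial derivatives of `u` at `0` of order at most `T`. -/
def derivSqSum (T : ℕ) (u : EuclideanSpace ℝ (Fin n) → ℝ) : ℝ :=
  ∑ m ∈ Finset.range (T + 1),
    ∑ α ∈ Finset.univ.filter (fun α : Fin n → Fin (m + 1) => (∑ i, (α i : ℕ)) = m),
      (mderiv (fun i => (α i : ℕ)) u 0) ^ 2

theorem derivSqSum_nonneg (T : ℕ) (u : EuclideanSpace ℝ (Fin n) → ℝ) : 0 ≤ derivSqSum T u :=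
  Finset.sum_nonneg fun _ _ => Finset.sum_nonneg fun _ _ => sq_nonneg _

theorem abs_foldr_pd_le_sqrt {T : ℕ} {u : EuclideanSpace ℝ (Fin n) → ℝ} (hu : ContDiff ℝ ∞ u)
    (l : List (Fin n)) (hl : l.length ≤ T) : |l.foldr pd u 0| ≤ √(derivSqSum T u) := by
  rw [foldr_pd_eq_mderiv hu]
  refine Real.abs_le_sqrt ?_
  set α : Fin n → Fin (l.length + 1) := fun i => ⟨l.count i, Nat.lt_succ_of_le List.count_le_length⟩
    with hα
  have hmem : α ∈ Finset.univ.filter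
      (fun α : Fin n → Fin (l.length + 1) => (∑ i, (α i : ℕ)) = l.length) := by
    rw [Finset.mem_filter]
    refine ⟨Finset.mem_univ _, ?_⟩
    simpa [hα] using Multiset.sum_count_eq_card (s := Finset.univ) (m := (l : Multiset (Fin n)))
      fun _ _ => Finset.mem_univ _
  have h1 := Finset.single_le_sum (f := fun α : Fin n → Fin (l.length + 1) =>
    (mderiv (fun i => (α i : ℕ)) u 0) ^ 2) (fun _ _ => sq_nonneg _) hmem
  refine h1.trans ?_
  exact Finset.single_le_sum (f := fun m => ∑ α ∈ Finset.univ.filter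
    (fun α : Fin n → Fin (m + 1) => (∑ i, (α i : ℕ)) = m), (mderiv (fun i => (α i : ℕ)) u 0) ^ 2)
    (fun _ _ => Finset.sum_nonneg fun _ _ => sq_nonneg _)
    (Finset.mem_range.2 (Nat.lt_succ_of_le hl))

theorem exists_sq_le_derivSqSum (hn : 0 < n) {N : ℝ} (hN : 0 ≤ N) :
    ∃ (T : ℕ) (C : ℝ), 0 < C ∧ ∀ u : EuclideanSpace ℝ (Fin n) → ℝ, ContDiff ℝ ∞ u →
      (∀ x ∈ ball (0 : EuclideanSpace ℝ (Fin n)) 1, lapl u x = 0) →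
      (∀ s, 0 < s → s < 1 → hfreq u s ≤ N) →
      ∀ x, ‖x‖ ≤ 1 / 8 → u x ^ 2 ≤ C * derivSqSum T u := by
  obtain ⟨k, hk⟩ := exists_wavg_mul_pow_le hn hN
  obtain ⟨C₀, hC₀, hsup⟩ := exists_sq_le_integral_bumpQ n
  obtain ⟨C₁, C₂, hC₁, hC₂, htaylor⟩ := exists_abs_le_taylor n k
  set Q := ∫ y, bumpQ n y with hQ
  have hQ0 : 0 < Q := integral_bumpQ_pos
  set ρ : ℝ := 1 / (4 * Q * C₂ ^ 2 * C₀ + 8) with hρdef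
  have hden : 0 < 4 * Q * C₂ ^ 2 * C₀ + 8 := by positivity
  have hρ : 0 < ρ := by positivity
  have hρ8 : ρ ≤ 1 / 8 := by
    apply one_div_le_one_div_of_le (by norm_num)
    have : 0 < 4 * Q * C₂ ^ 2 * C₀ := by positivity
    linarith
  have hρ1 : 4 * Q * C₂ ^ 2 * C₀ * ρ ≤ 1 := by
    rw [hρdef, mul_one_div, div_le_one hden]
    linarith
  refine ⟨k, C₀ * (4 * Q * C₁ ^ 2) / ρ ^ k, by positivity, fun u hu hu0 hf x hx => ?_⟩
  set S := √(derivSqSum k u) with hS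
  have hS2 : S ^ 2 = derivSqSum k u := Real.sq_sqrt (derivSqSum_nonneg k u)
  set W := wavg u 1 with hW
  have hW0 : 0 ≤ W := wavg_nonneg u 1
  have hsup' : ∀ y, ‖y‖ ≤ 1 / 4 → u y ^ 2 ≤ C₀ * W := by
    intro y hy
    simpa [hW, wavg] using hsup u hu hu0 y hy
  have hA : (√(C₀ * W)) ^ 2 = C₀ * W := Real.sq_sqrt (by positivity)
  have htay := htaylor u hu hu0 (√(C₀ * W)) S (fun y hy => Real.abs_le_sqrt (hsup' y hy))
    (fun l hl => abs_foldr_pd_le_sqrt hu l hl)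
  set B := C₁ * S + C₂ * ρ ^ (k + 1) * √(C₀ * W) with hB
  have hub : wavg u ρ ≤ Q * B ^ 2 := by
    rw [hQ, ← integral_mul_const]
    refine integral_mono ?_ ((contDiff_bumpQ.continuous.integrable_of_hasCompactSupport
      hasCompactSupport_bumpQ).mul_const _) fun y => ?_
    · have : Continuous fun y => u (ρ • y) ^ 2 :=
        (hu.continuous.comp (continuous_const_smul ρ)).pow 2
      exact (contDiff_bumpQ.continuous.mul this).integrable_of_hasCompactSupport
        hasCompactSupport_bumpQ.mul_right
    · change bumpQ n y * u (ρ • y) ^ 2 ≤ bumpQ n y * B ^ 2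
      by_cases hy : 1 ≤ ‖y‖
      · simp [bumpQ_eq_zero hy]
      · refine mul_le_mul_of_nonneg_left ?_ (bumpQ_nonneg y)
        have hyn : ‖ρ • y‖ ≤ ρ := by
          rw [norm_smul, Real.norm_of_nonneg hρ.le]
          exact mul_le_of_le_one_right hρ.le (not_le.1 hy).le
        have h1 := htay (ρ • y) (hyn.trans hρ8)
        refine sq_le_sq' ?_ ?_ <;>
        · have h2 : C₂ * ‖ρ • y‖ ^ (k + 1) * √(C₀ * W) ≤ C₂ * ρ ^ (k + 1) * √(C₀ * W) := by
            gcongr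
          have h3 := abs_le.1 h1
          linarith [h3.1, h3.2]
  have hB2 : B ^ 2 ≤ 2 * C₁ ^ 2 * S ^ 2 + 2 * C₂ ^ 2 * ρ ^ k * ρ * (C₀ * W) := by
    have h1 : B ^ 2 ≤ 2 * (C₁ * S) ^ 2 + 2 * (C₂ * ρ ^ (k + 1) * √(C₀ * W)) ^ 2 := by
      rw [hB]
      nlinarith [sq_nonneg (C₁ * S - C₂ * ρ ^ (k + 1) * √(C₀ * W))]
    have h2 : (C₂ * ρ ^ (k + 1) * √(C₀ * W)) ^ 2 ≤ C₂ ^ 2 * ρ ^ k * ρ * (C₀ * W) := by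
      rw [mul_pow, hA, mul_pow]
      have h3 : (ρ ^ (k + 1)) ^ 2 ≤ ρ ^ (k + 1) := by
        rw [sq]
        exact mul_le_of_le_one_left (by positivity) (pow_le_one₀ hρ.le (by linarith))
      rw [mul_assoc (C₂ ^ 2) (ρ ^ k) ρ, ← pow_succ]
      gcongr
    rw [mul_pow] at h1
    linarith
  have hkey := hk u hu hu0 hf ρ hρ (by linarith)
  have hWk : W * ρ ^ k ≤ 4 * Q * C₁ ^ 2 * S ^ 2 := by
    have h1 : Q * B ^ 2 ≤ Q * (2 * C₁ ^ 2 * S ^ 2 + 2 * C₂ ^ 2 * ρ ^ k * ρ * (C₀ * W)) := by gcongr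
    have h2 : 4 * Q * C₂ ^ 2 * C₀ * ρ * (W * ρ ^ k) ≤ 1 * (W * ρ ^ k) := by gcongr
    linarith
  have hW' : W ≤ 4 * Q * C₁ ^ 2 * S ^ 2 / ρ ^ k := (le_div_iff₀ (by positivity)).2 hWk
  calc u x ^ 2 ≤ C₀ * W := hsup' x (by linarith)
    _ ≤ C₀ * (4 * Q * C₁ ^ 2 * S ^ 2 / ρ ^ k) := by gcongr
    _ = _ := by rw [hS2]; ring

theorem eqOn_pd {f g : EuclideanSpace ℝ (Fin n) → ℝ} {s : Set (EuclideanSpace ℝ (Fin n))}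
    (hs : IsOpen s) (h : Set.EqOn f g s) (i : Fin n) : Set.EqOn (pd i f) (pd i g) s := by
  intro x hx
  have : f =ᶠ[nhds x] g := by filter_upwards [hs.mem_nhds hx] with y hy using h hy
  rw [pd, pd, this.fderiv_eq]

theorem eqOn_mderiv {f g : EuclideanSpace ℝ (Fin n) → ℝ} {s : Set (EuclideanSpace ℝ (Fin n))}
    (hs : IsOpen s) (h : Set.EqOn f g s) (α : Fin n → ℕ) :
    Set.EqOn (mderiv α f) (mderiv α g) s := by
  have hit : ∀ (i : Fin n) (k : ℕ) {f g : EuclideanSpace ℝ (Fin n) → ℝ}, Set.EqOn f g s →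
      Set.EqOn ((pd i)^[k] f) ((pd i)^[k] g) s := by
    intro i k
    induction k with
    | zero => exact fun h => h
    | succ k ih => exact fun h => ih (eqOn_pd hs h i)
  rw [mderiv, mderiv]
  induction List.finRange n with
  | nil => exact h
  | cons i l ih => exact hit i _ ih

theorem hfreq_congr {f g : EuclideanSpace ℝ (Fin n) → ℝ} {R r : ℝ} (hr : r < R)
    (h : Set.EqOn f g (ball 0 R)) : hfreq f r = hfreq g r := by
  have h1 : ∫ x in closedBall (0 : EuclideanSpace ℝ (Fin n)) r, ∑ i, (pd i f x) ^ 2 =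
      ∫ x in closedBall (0 : EuclideanSpace ℝ (Fin n)) r, ∑ i, (pd i g x) ^ 2 :=
    setIntegral_congr_fun isClosed_closedBall.measurableSet fun x hx =>
      Finset.sum_congr rfl fun i _ => by
        rw [eqOn_pd isOpen_ball h i (closedBall_subset_ball hr hx)]
  have h2 : ∫ x in sphere (0 : EuclideanSpace ℝ (Fin n)) r, f x ^ 2 ∂ μH[(n : ℝ) - 1] =
      ∫ x in sphere (0 : EuclideanSpace ℝ (Fin n)) r, g x ^ 2 ∂ μH[(n : ℝ) - 1] :=
    setIntegral_congr_fun isClosed_sphere.measurableSet fun x hx => by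
      rw [h (closedBall_subset_ball hr (sphere_subset_closedBall hx))]
  rw [hfreq, hfreq, h1, h2]

theorem exists_contDiff_eqOn_ball {u : EuclideanSpace ℝ (Fin n) → ℝ}
    (hu : ContDiffOn ℝ ∞ u (closedBall 0 2)) :
    ∃ v : EuclideanSpace ℝ (Fin n) → ℝ, ContDiff ℝ ∞ v ∧ Set.EqOn v u (ball 0 (3 / 2)) := by
  set χ : ContDiffBump (0 : EuclideanSpace ℝ (Fin n)) :=
    ⟨3 / 2, 7 / 4, by norm_num, by norm_num⟩ with hχ
  refine ⟨fun x => χ x * u x, contDiff_iff_contDiffAt.2 fun x => ?_, fun x hx => ?_⟩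
  · by_cases hx : x ∈ ball (0 : EuclideanSpace ℝ (Fin n)) 2
    · exact χ.contDiffAt.mul (hu.contDiffAt (Filter.mem_of_superset (isOpen_ball.mem_nhds hx)
        ball_subset_closedBall))
    · have hmem : (closedBall (0 : EuclideanSpace ℝ (Fin n)) (7 / 4))ᶜ ∈ nhds x := by
        refine isClosed_closedBall.isOpen_compl.mem_nhds fun hx' => hx ?_
        exact closedBall_subset_ball (by norm_num) hx'
      have h0 : (fun x => χ x * u x) =ᶠ[nhds x] fun _ => 0 := by
        filter_upwards [hmem] with y hy
        rw [χ.zero_of_le_dist, zero_mul]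
        exact (not_le.1 (mt mem_closedBall.2 hy)).le
      exact contDiffAt_const.congr_of_eventuallyEq h0
  · have : χ x = 1 := χ.one_of_mem_closedBall (ball_subset_closedBall hx)
    simp [this]

end Main

/-- The conclusion of Section 4 of the paper: Conjecture 1.3 via Theorem 1.10, for harmonic
functions with bounded frequency:
`sup_{B(0,1/8)} |u|² ≤ C Σ_{m=0}^{T} Σ_{|α|=m} |D^α u(0)|²`. -/
theorem stmt_19 (n : ℕ) (hn : 2 ≤ n) (N : ℝ) (hN : 0 < N) (M : ℝ) (hM : 2 ≤ M) :
    ∃ (T : ℕ) (C : ℝ), 0 < C ∧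
      ∀ u : EuclideanSpace ℝ (Fin n) → ℝ,
        ContDiffOn ℝ (⊤ : ℕ∞) u (closedBall (0 : EuclideanSpace ℝ (Fin n)) M) →
        (∀ x ∈ closedBall (0 : EuclideanSpace ℝ (Fin n)) M, ∑ i, pd i (pd i u) x = 0) →
        (∃ x ∈ closedBall (0 : EuclideanSpace ℝ (Fin n)) M, u x ≠ 0) →
        (∀ r : ℝ, 0 < r → r < M → hfreq u r ≤ N) →
        supBall u 0 (1 / 8) ^ 2 ≤ C * ∑ m ∈ Finset.range (T + 1),
          ∑ α ∈ Finset.univ.filter (fun α : Fin n → Fin (m + 1) => (∑ i, (α i : ℕ)) = m),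
            (mderiv (fun i => (α i : ℕ)) u 0) ^ 2 := by
  obtain ⟨T, C, hC, h⟩ := exists_sq_le_derivSqSum (n := n) (by omega) hN.le
  refine ⟨T, C, hC, fun u hu hharm _ hf => ?_⟩
  obtain ⟨v, hv, hvu⟩ := exists_contDiff_eqOn_ball (hu.mono (closedBall_subset_closedBall hM))
  have hpd : ∀ i, Set.EqOn (pd i (pd i v)) (pd i (pd i u)) (ball 0 (3 / 2)) := fun i =>
    eqOn_pd isOpen_ball (eqOn_pd isOpen_ball hvu i) i
  have hbound := h v hv
    (fun x hx => by
      have hx' : x ∈ ball (0 : EuclideanSpace ℝ (Fin n)) (3 / 2) :=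
        ball_subset_ball (by norm_num) hx
      rw [lapl, Finset.sum_congr rfl fun i _ => hpd i hx']
      exact hharm x (ball_subset_closedBall (ball_subset_ball (by linarith) hx)))
    (fun s hs hs1 => by
      rw [hfreq_congr (by linarith : s < 3 / 2) hvu]
      exact hf s hs (by linarith))
  have hsum : derivSqSum T v = derivSqSum T u :=
    Finset.sum_congr rfl fun m _ => Finset.sum_congr rfl fun α _ => by
      rw [eqOn_mderiv isOpen_ball hvu _ (mem_ball_self (by norm_num))]
  change supBall u 0 (1 / 8) ^ 2 ≤ C * derivSqSum T u
  have hnn : 0 ≤ C * derivSqSum T u := mul_nonneg hC.le (derivSqSum_nonneg T u)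
  have hsup : supBall u 0 (1 / 8) ≤ √(C * derivSqSum T u) := by
    refine Real.iSup_le (fun x => Real.abs_le_sqrt ?_) (Real.sqrt_nonneg _)
    have hx : ‖(x : EuclideanSpace ℝ (Fin n))‖ ≤ 1 / 8 := mem_closedBall_zero_iff.1 x.2
    rw [← hvu (mem_ball_zero_iff.2 (by linarith)), ← hsum]
    exact hbound x hx
  calc supBall u 0 (1 / 8) ^ 2 ≤ √(C * derivSqSum T u) ^ 2 :=
        pow_le_pow_left₀ (Real.iSup_nonneg fun _ => abs_nonneg _) hsup 2
    _ = _ := Real.sq_sqrt hnn
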